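/- Let n ≥ 2. Then ∫_{ℝⁿ} |Δu|² dx ≥ (n(n−4)/4)² ∫_{ℝⁿ} |x|^{−4} |u|² dx for every radial u ∈ C²_c(ℝⁿ∖{0}), and ∫_{ℝⁿ} |Δu|² dx ≥ ((n²−4)/4)² ∫_{ℝⁿ} |x|^{−4} |u|² dx for every u ∈ C²_c(ℝⁿ∖{0}) with ∫_{∂B_r} u dσ = 0 for every r > 0; both constants are sharp, i.e. equal to the corresponding infima of the Rellich quotient over these classes. -/

import Mathlib

open MeasureTheory Metric Set Filter
open scoped RealInnerProductSpace

noncomputable section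

/-- The Euclidean Laplacian of `u : ℝⁿ → ℝ` at a point. -/
def lap {n : ℕ} (u : EuclideanSpace ℝ (Fin n) → ℝ) (x : EuclideanSpace ℝ (Fin n)) : ℝ :=
  ∑ i : Fin n, iteratedFDeriv ℝ 2 u x ![EuclideanSpace.single i 1, EuclideanSpace.single i 1]

/-- The Laplace–Beltrami operator on the unit sphere, computed via the
`0`-homogeneous extension: for a `0`-homogeneous function the Euclidean Laplacian
restricted to the unit sphere is exactly the Laplace–Beltrami operator. -/
def sphLap {n : ℕ} (φ : EuclideanSpace ℝ (Fin n) → ℝ) (σ : EuclideanSpace ℝ (Fin n)) : ℝ :=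
  lap (fun x => φ (‖x‖⁻¹ • x)) σ

/-- Squared norm of the spherical gradient, via the `0`-homogeneous extension. -/
def sphGradNormSq {n : ℕ} (φ : EuclideanSpace ℝ (Fin n) → ℝ) (σ : EuclideanSpace ℝ (Fin n)) : ℝ :=
  ‖fderiv ℝ (fun x => φ (‖x‖⁻¹ • x)) σ‖ ^ 2

/-- The open cone `C_Σ = {rσ : r > 0, σ ∈ Σ}` over a subset of the unit sphere. -/
def coneOf {n : ℕ} (S : Set (EuclideanSpace ℝ (Fin n))) : Set (EuclideanSpace ℝ (Fin n)) :=
  {x | x ≠ 0 ∧ ‖x‖⁻¹ • x ∈ S}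

/-- The canonical surface measure `dσ` on the unit sphere of `ℝⁿ`, as a measure on `ℝⁿ`. -/
def sphMeasure (n : ℕ) : Measure (EuclideanSpace ℝ (Fin n)) :=
  Measure.map Subtype.val
    ((volume : Measure (EuclideanSpace ℝ (Fin n))).toSphere)

/-- A (Dirichlet) eigenfunction of the Laplace–Beltrami operator on `S ⊆ 𝕊^{n-1}`
relative to the eigenvalue `lam`. -/
def IsEigenfun {n : ℕ} (S : Set (EuclideanSpace ℝ (Fin n))) (lam : ℝ)
    (φ : EuclideanSpace ℝ (Fin n) → ℝ) : Prop :=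
  ContinuousOn (fun x => φ (‖x‖⁻¹ • x)) (coneOf (closure S)) ∧
  ContDiffOn ℝ 2 (fun x => φ (‖x‖⁻¹ • x)) (coneOf S) ∧
  (∀ σ ∈ closure S \ S, φ σ = 0) ∧
  (∃ σ ∈ S, φ σ ≠ 0) ∧
  (∀ σ ∈ S, - sphLap φ σ = lam * φ σ)

/-- The Dirichlet spectrum `Λ(Σ)` of the Laplace–Beltrami operator on `S`. -/
def spec {n : ℕ} (S : Set (EuclideanSpace ℝ (Fin n))) : Set ℝ :=
  {lam | ∃ φ, IsEigenfun S lam φ}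

/-- `S` is a domain in the unit sphere `𝕊^{n-1}`: a relatively open connected
nonempty subset. -/
def IsSphDomain {n : ℕ} (S : Set (EuclideanSpace ℝ (Fin n))) : Prop :=
  S ⊆ Metric.sphere (0 : EuclideanSpace ℝ (Fin n)) 1 ∧
  IsOpen (Subtype.val ⁻¹' S : Set (Metric.sphere (0 : EuclideanSpace ℝ (Fin n)) 1)) ∧
  IsConnected S

/-- `S` is a domain of class `C²` in the unit sphere: a domain such that the cone
over it admits local `C²` defining functions away from the origin. -/
def IsC2SphDomain {n : ℕ} (S : Set (EuclideanSpace ℝ (Fin n))) : Prop :=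
  IsSphDomain S ∧
  ∀ x ∈ frontier (coneOf S) \ {0}, ∃ (U : Set (EuclideanSpace ℝ (Fin n)))
    (f : EuclideanSpace ℝ (Fin n) → ℝ), IsOpen U ∧ x ∈ U ∧ ContDiff ℝ 2 f ∧
    fderiv ℝ f x ≠ 0 ∧ coneOf S ∩ U = {y ∈ U | f y < 0}

/-- `γ_{n,α} = ((n-2)/2)² - ((α-2)/2)²`. -/
def gam (n : ℕ) (α : ℝ) : ℝ := (((n : ℝ) - 2) / 2) ^ 2 - ((α - 2) / 2) ^ 2

/-- `γ̄_{n,α} = ((n-2)/2)² + ((α-2)/2)²`. -/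
def gbar (n : ℕ) (α : ℝ) : ℝ := (((n : ℝ) - 2) / 2) ^ 2 + ((α - 2) / 2) ^ 2

/-- The class `C²_c(Ω̄ ∖ {0})` of Navier test functions: `C²` up to the closure of
`Ω`, vanishing on `∂Ω` and in a neighborhood of `0` and of `∞`. -/
def NavierAdm {n : ℕ} (Ω : Set (EuclideanSpace ℝ (Fin n)))
    (u : EuclideanSpace ℝ (Fin n) → ℝ) : Prop :=
  ContDiffOn ℝ 2 u (closure Ω) ∧
  (∀ x ∈ frontier Ω, u x = 0) ∧
  (∃ ε > 0, ∀ x : EuclideanSpace ℝ (Fin n), ‖x‖ < ε → u x = 0) ∧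
  (∃ R : ℝ, ∀ x : EuclideanSpace ℝ (Fin n), R < ‖x‖ → u x = 0)

/-- The class `C²_c(Ω)` of Dirichlet test functions: globally `C²` with compact
support contained in `Ω`. -/
def DirichletAdm {n : ℕ} (Ω : Set (EuclideanSpace ℝ (Fin n)))
    (u : EuclideanSpace ℝ (Fin n) → ℝ) : Prop :=
  ContDiff ℝ 2 u ∧ HasCompactSupport u ∧ tsupport u ⊆ Ω

/-- The best Rellich constant `μ_N(Ω;α)` under Navier boundary conditions. -/
def muN {n : ℕ} (Ω : Set (EuclideanSpace ℝ (Fin n))) (α : ℝ) : ℝ :=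
  sInf {q : ℝ | ∃ u, NavierAdm Ω u ∧ (∃ x ∈ Ω, u x ≠ 0) ∧
    q = (∫ x in Ω, ‖x‖ ^ α * (lap u x) ^ 2) / (∫ x in Ω, ‖x‖ ^ (α - 4) * (u x) ^ 2)}

/-- The best Rellich constant `μ_D(Ω;α)` under Dirichlet boundary conditions. -/
def muD {n : ℕ} (Ω : Set (EuclideanSpace ℝ (Fin n))) (α : ℝ) : ℝ :=
  sInf {q : ℝ | ∃ u, DirichletAdm Ω u ∧ (∃ x ∈ Ω, u x ≠ 0) ∧
    q = (∫ x in Ω, ‖x‖ ^ α * (lap u x) ^ 2) / (∫ x in Ω, ‖x‖ ^ (α - 4) * (u x) ^ 2)}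

/-- The surrogate of `H² ∩ H¹₀(Σ)`: functions whose `0`-homogeneous extension is
`C²` up to the closure of the cone, vanishing on the relative boundary of `S`. -/
def NavAdmS {n : ℕ} (S : Set (EuclideanSpace ℝ (Fin n)))
    (φ : EuclideanSpace ℝ (Fin n) → ℝ) : Prop :=
  ContDiffOn ℝ 2 (fun x => φ (‖x‖⁻¹ • x)) (coneOf (closure S)) ∧
  (∀ σ ∈ closure S \ S, φ σ = 0)

/-- The surrogate of `H²₀(Σ)`: as `NavAdmS`, with in addition vanishing gradient
on the relative boundary of `S`. -/
def DirAdmS {n : ℕ} (S : Set (EuclideanSpace ℝ (Fin n)))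
    (φ : EuclideanSpace ℝ (Fin n) → ℝ) : Prop :=
  NavAdmS S φ ∧
  ∀ σ ∈ closure S \ S,
    fderivWithin ℝ (fun x => φ (‖x‖⁻¹ • x)) (coneOf (closure S)) σ = 0

/-- The Rayleigh-type quotient `∫_Σ |Lφ|² dσ / ∫_Σ |φ|² dσ` with
`Lφ = -Δ_σ φ + γ φ`. -/
def sphQuot {n : ℕ} (S : Set (EuclideanSpace ℝ (Fin n))) (γ : ℝ)
    (φ : EuclideanSpace ℝ (Fin n) → ℝ) : ℝ :=
  (∫ σ in S, (- sphLap φ σ + γ * φ σ) ^ 2 ∂(sphMeasure n)) /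
    (∫ σ in S, (φ σ) ^ 2 ∂(sphMeasure n))

/-- Partial derivative `w_s` of a function on the cylinder `ℝ × 𝕊^{n-1}`. -/
def ws {n : ℕ} (w : ℝ × EuclideanSpace ℝ (Fin n) → ℝ)
    (p : ℝ × EuclideanSpace ℝ (Fin n)) : ℝ :=
  deriv (fun t => w (t, p.2)) p.1

/-- Second partial derivative `w_ss` of a function on the cylinder. -/
def wss {n : ℕ} (w : ℝ × EuclideanSpace ℝ (Fin n) → ℝ)
    (p : ℝ × EuclideanSpace ℝ (Fin n)) : ℝ :=
  deriv (fun t => ws w (t, p.2)) p.1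

end

open MeasureTheory Metric Set Filter
open scoped RealInnerProductSpace
set_option linter.unusedSectionVars false

noncomputable section

section gauss
variable {E : Type*} [NormedAddCommGroup E] [InnerProductSpace ℝ E] [FiniteDimensional ℝ E]
  [MeasurableSpace E] [BorelSpace E]

/-- The unnormalised Gaussian weight. -/
def gw (x : E) : ℝ := Real.exp (-(1/2) * ‖x‖ ^ 2)

lemma gw_cont : Continuous (gw : E → ℝ) := by unfold gw; fun_prop

lemma gw_pos (x : E) : 0 < gw x := Real.exp_pos _

lemma gw_int [Nontrivial E] : Integrable (fun x : E => (1 + ‖x‖) * gw x) := by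
  have := (integrable_fun_norm_addHaar (volume : Measure E)
    (f := fun r : ℝ => (1 + r) * Real.exp (-(1/2) * r ^ 2))).2 ?_
  · exact this
  · have h1 : IntegrableOn (fun r : ℝ => r ^ ((Module.finrank ℝ E - 1 : ℕ) : ℝ) * Real.exp (-(1/2) * r ^ 2)) (Ioi 0) :=
      integrableOn_rpow_mul_exp_neg_mul_sq (by norm_num) (by
        have : (0:ℝ) ≤ ((Module.finrank ℝ E - 1 : ℕ) : ℝ) := by positivity
        linarith)
    have h2 : IntegrableOn (fun r : ℝ => r ^ ((Module.finrank ℝ E - 1 + 1 : ℕ) : ℝ) * Real.exp (-(1/2) * r ^ 2)) (Ioi 0) :=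
      integrableOn_rpow_mul_exp_neg_mul_sq (by norm_num) (by
        have : (0:ℝ) ≤ ((Module.finrank ℝ E - 1 + 1 : ℕ) : ℝ) := by positivity
        linarith)
    refine (h1.add h2).congr (Eventually.of_forall fun r => ?_)
    simp only [Real.rpow_natCast, smul_eq_mul, pow_succ, Pi.add_apply]
    ring

lemma gw_prod_int [Nontrivial E] {h : E × E → ℝ} (hc : AEStronglyMeasurable h) {M : ℝ}
    (hM : ∀ p, |h p| ≤ M * ((1 + ‖p.1‖) * (1 + ‖p.2‖))) :
    Integrable (fun p : E × E => h p * (gw p.1 * gw p.2)) := by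
  have := ((gw_int (E := E)).mul_prod (gw_int (E := E))).const_mul M
  refine this.mono' ?_ (Eventually.of_forall fun p => ?_)
  · refine hc.mul (Continuous.aestronglyMeasurable ?_)
    exact (gw_cont.comp continuous_fst).mul (gw_cont.comp continuous_snd)
  · have h1 := gw_pos p.1
    have h2 := gw_pos p.2
    rw [Real.norm_eq_abs, abs_mul, abs_of_pos (mul_pos h1 h2)]
    calc _ ≤ M * ((1 + ‖p.1‖) * (1 + ‖p.2‖)) * (gw p.1 * gw p.2) := by gcongr; exact hM p
      _ = _ := by ring

lemma gw_hasFDerivAt (x : E) : HasFDerivAt gw (-(gw x) • innerSL ℝ x) x := by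
  have h1 : HasFDerivAt (fun x : E => -(1/2) * ‖x‖ ^ 2) (-(1/2 : ℝ) • ((2:ℕ) • innerSL ℝ x)) x := by
    have := (hasStrictFDerivAt_norm_sq x).hasFDerivAt.const_mul (-(1/2 : ℝ))
    exact this
  refine h1.exp.congr_fderiv ?_
  ext y; simp [gw]

/-- rotation of `E × E` preserves Lebesgue measure. -/
lemma rot_mp (c s : ℝ) (h : c ^ 2 + s ^ 2 = 1) :
    MeasurePreserving (fun p : E × E => (c • p.1 - s • p.2, s • p.1 + c • p.2)) := by
  let L : WithLp 2 (E × E) →ₗ[ℝ] WithLp 2 (E × E) :=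
    { toFun := fun p => WithLp.toLp 2 (c • p.fst - s • p.snd, s • p.fst + c • p.snd)
      map_add' := by
        intro x y; apply (WithLp.ofLp_injective 2); ext <;> simp <;> module
      map_smul' := by
        intro r x; apply (WithLp.ofLp_injective 2); ext <;> simp <;> module }
  let LI : WithLp 2 (E × E) →ₗᵢ[ℝ] WithLp 2 (E × E) :=
    { toLinearMap := L
      norm_map' := by
        intro x
        have : ‖L x‖ ^ 2 = ‖x‖ ^ 2 := by
          rw [WithLp.prod_norm_sq_eq_of_L2, WithLp.prod_norm_sq_eq_of_L2]
          show ‖c • x.fst - s • x.snd‖ ^ 2 + ‖s • x.fst + c • x.snd‖ ^ 2 = _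
          rw [norm_sub_sq_real, norm_add_sq_real]
          simp only [norm_smul, inner_smul_left, inner_smul_right, mul_pow, Real.norm_eq_abs, sq_abs]
          simp
          linear_combination (‖x.fst‖ ^ 2 + ‖x.snd‖ ^ 2) * h
        exact (sq_eq_sq₀ (norm_nonneg _) (norm_nonneg _)).1 this }
  let e := LI.toLinearIsometryEquiv rfl
  have h1 := e.measurePreserving
  have h2 := (WithLp.volume_preserving_ofLp E E).comp (h1.comp (WithLp.volume_preserving_toLp E E))
  exact h2

lemma gw_rot (c s : ℝ) (h : c ^ 2 + s ^ 2 = 1) (x y : E) :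
    gw (c • x - s • y) * gw (s • x + c • y) = gw x * gw y := by
  unfold gw
  rw [← Real.exp_add, ← Real.exp_add]
  congr 1
  rw [norm_sub_sq_real, norm_add_sq_real]
  simp only [norm_smul, inner_smul_left, inner_smul_right, mul_pow, Real.norm_eq_abs, sq_abs]
  simp
  linear_combination (-(1/2) * (‖x‖ ^ 2 + ‖y‖ ^ 2)) * h

lemma rot_integral (c s : ℝ) (h : c ^ 2 + s ^ 2 = 1) (f : E × E → ℝ) :
    ∫ p : E × E, f (c • p.1 - s • p.2, s • p.1 + c • p.2) * (gw p.1 * gw p.2) =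
      ∫ p : E × E, f p * (gw p.1 * gw p.2) := by
  have hmp := rot_mp (E := E) c s h
  have hmp' := rot_mp (E := E) c (-s) (by simpa using h)
  have hemb : MeasurableEmbedding (fun p : E × E => (c • p.1 - s • p.2, s • p.1 + c • p.2)) := by
    let e : (E × E) ≃ᵐ (E × E) :=
      { toFun := fun p : E × E => (c • p.1 - s • p.2, s • p.1 + c • p.2)
        invFun := fun p : E × E => (c • p.1 - (-s) • p.2, (-s) • p.1 + c • p.2)
        left_inv := by
          intro p
          ext
          · simp only
            have : p.1 = (c ^ 2 + s ^ 2) • p.1 := by rw [h, one_smul]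
            conv_rhs => rw [this]
            module
          · simp only
            have : p.2 = (c ^ 2 + s ^ 2) • p.2 := by rw [h, one_smul]
            conv_rhs => rw [this]
            module
        right_inv := by
          intro p
          ext
          · simp only
            have : p.1 = (c ^ 2 + s ^ 2) • p.1 := by rw [h, one_smul]
            conv_rhs => rw [this]
            module
          · simp only
            have : p.2 = (c ^ 2 + s ^ 2) • p.2 := by rw [h, one_smul]
            conv_rhs => rw [this]
            module
        measurable_toFun := hmp.measurable
        measurable_invFun := hmp'.measurable }
    exact e.measurableEmbedding
  rw [← hmp.integral_comp hemb (fun p => f p * (gw p.1 * gw p.2))]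
  refine integral_congr_ae (Eventually.of_forall fun p => ?_)
  simp only [gw_rot c s h]

end gauss
end

open MeasureTheory Metric Set Filter
open scoped RealInnerProductSpace
set_option linter.unusedSectionVars false
noncomputable section

section gauss
variable {E : Type*} [NormedAddCommGroup E] [InnerProductSpace ℝ E] [FiniteDimensional ℝ E]
  [MeasurableSpace E] [BorelSpace E]

/-- Gaussian integration by parts. -/
lemma stein [Nontrivial E] {H : E → ℝ} (hH : ContDiff ℝ 1 H) {M : ℝ} (hM : ∀ x, |H x| ≤ M)
    (hM' : ∀ x, ‖fderiv ℝ H x‖ ≤ M) (v : E) :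
    ∫ y, H y * ⟪v, y⟫ * gw y = ∫ y, fderiv ℝ H y v * gw y := by
  have hfw : ∀ y : E, fderiv ℝ gw y v = - (⟪v, y⟫ * gw y) := by
    intro y
    rw [(gw_hasFDerivAt y).fderiv]; simp [real_inner_comm]; ring
  have hM0 : 0 ≤ M := (abs_nonneg _).trans (hM 0)
  have hcf : Continuous fun y => fderiv ℝ H y v :=
    (hH.continuous_fderiv (by norm_num)).clm_apply continuous_const
  have hg1 : ∀ y : E, 0 < gw y := gw_pos
  have h := integral_mul_fderiv_eq_neg_fderiv_mul_of_integrable (μ := (volume : Measure E))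
    (f := H) (g := gw) (v := v) ?_ ?_ ?_ (fun x _ => (hH.differentiable (by norm_num)) x)
    (fun x _ => (gw_hasFDerivAt x).differentiableAt)
  · simp only [hfw] at h
    simp only [mul_neg, integral_neg, neg_inj] at h
    simpa [mul_assoc] using h
  · refine ((gw_int (E := E)).const_mul (M * ‖v‖)).mono' (hcf.mul gw_cont).aestronglyMeasurable
      (Eventually.of_forall fun y => ?_)
    rw [norm_mul, Real.norm_of_nonneg (hg1 y).le]
    have : ‖fderiv ℝ H y v‖ ≤ M * ‖v‖ := ((fderiv ℝ H y).le_opNorm v).trans (by gcongr; exact hM' y)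
    calc _ ≤ M * ‖v‖ * gw y := by have := (hg1 y).le; gcongr
      _ ≤ M * ‖v‖ * ((1 + ‖y‖) * gw y) := by
        have := (hg1 y).le
        gcongr
        nlinarith [norm_nonneg y]
  · simp only [hfw]
    refine ((gw_int (E := E)).const_mul (M * ‖v‖)).mono' ?_
      (Eventually.of_forall fun y => ?_)
    · exact (hH.continuous.mul ((continuous_const.inner continuous_id).mul gw_cont).neg).aestronglyMeasurable
    have : ‖H y‖ ≤ M := hM y
    rw [norm_mul, norm_neg, norm_mul, Real.norm_of_nonneg (hg1 y).le]
    have h2 : ‖⟪v, y⟫‖ ≤ ‖v‖ * ‖y‖ := norm_inner_le_norm v y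
    have := (hg1 y).le
    calc _ ≤ M * (‖v‖ * ‖y‖ * gw y) := by gcongr
      _ = M * ‖v‖ * (‖y‖ * gw y) := by ring
      _ ≤ M * ‖v‖ * ((1 + ‖y‖) * gw y) := by gcongr; linarith
  · refine ((gw_int (E := E)).const_mul M).mono' (hH.continuous.mul gw_cont).aestronglyMeasurable
      (Eventually.of_forall fun y => ?_)
    rw [norm_mul, Real.norm_of_nonneg (hg1 y).le]
    have : ‖H y‖ ≤ M := hM y
    have := (hg1 y).le
    calc _ ≤ M * gw y := by gcongr
      _ ≤ M * ((1 + ‖y‖) * gw y) := by gcongr; nlinarith [norm_nonneg y]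

/-- the Ornstein-Uhlenbeck covariance -/
def ouc (F : E → ℝ) (t : ℝ) : ℝ :=
  ∫ p : E × E, F p.1 * F (Real.cos t • p.1 + Real.sin t • p.2) * (gw p.1 * gw p.2)

lemma bddF {F : E → ℝ} (hF : ContDiff ℝ 1 F) (hc : HasCompactSupport F) :
    ∃ M : ℝ, 0 ≤ M ∧ (∀ x, |F x| ≤ M) ∧ (∀ x, ‖fderiv ℝ F x‖ ≤ M) := by
  obtain ⟨C, hC⟩ := hF.continuous.bounded_above_of_compact_support hc
  obtain ⟨C', hC'⟩ := (hF.continuous_fderiv (by norm_num)).bounded_above_of_compact_support (hc.fderiv (𝕜 := ℝ))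
  refine ⟨max C C', ?_, fun x => (hC x).trans (le_max_left _ _), fun x => (hC' x).trans (le_max_right _ _)⟩
  exact (norm_nonneg _).trans ((hC 0).trans (le_max_left _ _))

set_option maxHeartbeats 1000000 in
lemma ouc_deriv [Nontrivial E] {F : E → ℝ} (hF : ContDiff ℝ 1 F) (hc : HasCompactSupport F) (t : ℝ) :
    HasDerivAt (ouc F) (∫ p : E × E, F p.1 * (fderiv ℝ F (Real.cos t • p.1 + Real.sin t • p.2)
      (-Real.sin t • p.1 + Real.cos t • p.2)) * (gw p.1 * gw p.2)) t := by
  obtain ⟨M, hM0, hM, hM'⟩ := bddF hF hc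
  have hcF := hF.continuous
  have hcF' := hF.continuous_fderiv (by norm_num)
  have hint := ((gw_int (E := E)).mul_prod (gw_int (E := E))).const_mul (M * M)
  refine (hasDerivAt_integral_of_dominated_loc_of_deriv_le (μ := (volume : Measure (E × E))) (x₀ := t) (s := univ)
    (F := fun (t : ℝ) (p : E × E) => F p.1 * F (Real.cos t • p.1 + Real.sin t • p.2) * (gw p.1 * gw p.2))
    (F' := fun (t : ℝ) (p : E × E) => F p.1 * (fderiv ℝ F (Real.cos t • p.1 + Real.sin t • p.2)
      (-Real.sin t • p.1 + Real.cos t • p.2)) * (gw p.1 * gw p.2)) (bound := fun p : E × E => (M * M) * (((1 + ‖p.1‖) * gw p.1) * ((1 + ‖p.2‖) * gw p.2)))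
    univ_mem ?_ ?_ ?_ ?_ hint ?_).2
  · refine Eventually.of_forall fun t => Continuous.aestronglyMeasurable ?_
    exact ((hcF.comp continuous_fst).mul (hcF.comp (by fun_prop))).mul
      ((gw_cont.comp continuous_fst).mul (gw_cont.comp continuous_snd))
  · refine gw_prod_int (M := M * M) (Continuous.aestronglyMeasurable
      ((hcF.comp continuous_fst).mul (hcF.comp (by fun_prop)))) fun p => ?_
    rw [abs_mul]
    calc _ ≤ M * M * (1 * 1) := by
          rw [one_mul, mul_one]
          exact mul_le_mul (hM _) (hM _) (abs_nonneg _) hM0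
      _ ≤ _ := by gcongr <;> linarith [norm_nonneg p.1, norm_nonneg p.2]
  · refine Continuous.aestronglyMeasurable ?_
    exact ((hcF.comp continuous_fst).mul ((hcF'.comp (by fun_prop)).clm_apply (by fun_prop))).mul
      ((gw_cont.comp continuous_fst).mul (gw_cont.comp continuous_snd))
  · refine Eventually.of_forall fun p r _ => ?_
    have h1 := gw_pos p.1
    have h2 := gw_pos p.2
    rw [norm_mul, Real.norm_of_nonneg (mul_pos h1 h2).le, norm_mul]
    have h3 : ‖fderiv ℝ F (Real.cos r • p.1 + Real.sin r • p.2)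
      (-Real.sin r • p.1 + Real.cos r • p.2)‖ ≤ M * (‖p.1‖ + ‖p.2‖) := by
      refine (ContinuousLinearMap.le_opNorm _ _).trans ?_
      refine mul_le_mul (hM' _) ?_ (norm_nonneg _) hM0
      refine (norm_add_le _ _).trans ?_
      rw [norm_smul, norm_smul, norm_neg]
      have := Real.abs_sin_le_one r
      have := Real.abs_cos_le_one r
      simp only [Real.norm_eq_abs]
      nlinarith [norm_nonneg p.1, norm_nonneg p.2]
    calc _ ≤ M * (M * (‖p.1‖ + ‖p.2‖)) * (gw p.1 * gw p.2) := by
          refine mul_le_mul_of_nonneg_right ?_ (mul_pos h1 h2).le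
          exact mul_le_mul (hM _) h3 (norm_nonneg _) hM0
      _ ≤ M * (M * ((1 + ‖p.1‖) * (1 + ‖p.2‖))) * (gw p.1 * gw p.2) := by
          gcongr
          nlinarith [norm_nonneg p.1, norm_nonneg p.2, mul_nonneg (norm_nonneg p.1) (norm_nonneg p.2)]
      _ = _ := by ring
  · refine Eventually.of_forall fun p r _ => ?_
    refine HasDerivAt.mul_const ?_ _
    refine HasDerivAt.const_mul _ ?_
    have h1 : HasDerivAt (fun r : ℝ => Real.cos r • p.1 + Real.sin r • p.2)
      (-Real.sin r • p.1 + Real.cos r • p.2) r :=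
      ((Real.hasDerivAt_cos r).smul_const p.1).add ((Real.hasDerivAt_sin r).smul_const p.2)
    exact (((hF.differentiable (by norm_num)) _).hasFDerivAt).comp_hasDerivAt r h1

lemma ouc_deriv_ge [Nontrivial E] {F : E → ℝ} (hF : ContDiff ℝ 1 F) (hc : HasCompactSupport F) (t : ℝ)
    (ht : 0 ≤ Real.sin t) :
    -(Real.sin t * ((∫ x : E, ‖fderiv ℝ F x‖ ^ 2 * gw x) * ∫ x : E, gw x)) ≤
    (∫ p : E × E, F p.1 * (fderiv ℝ F (Real.cos t • p.1 + Real.sin t • p.2)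
      (-Real.sin t • p.1 + Real.cos t • p.2)) * (gw p.1 * gw p.2)) := by
  obtain ⟨M, hM0, hM, hM'⟩ := bddF hF hc
  have hcF := hF.continuous
  have hcF' := hF.continuous_fderiv (by norm_num)
  have hcs : Real.cos t ^ 2 + Real.sin t ^ 2 = 1 := Real.cos_sq_add_sin_sq t
  set c := Real.cos t
  set s := Real.sin t
  have hgrad : ∀ x y : E, ⟪gradient F x, y⟫ = fderiv ℝ F x y := fun x y => by
    simp [gradient]
  have hgn : ∀ x : E, ‖gradient F x‖ = ‖fderiv ℝ F x‖ := fun x => by simp [gradient]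
  have hcg : Continuous (gradient F) := by
    unfold gradient
    exact (LinearIsometryEquiv.continuous _).comp hcF'
  have e1 : (∫ p : E × E, F p.1 * (fderiv ℝ F (c • p.1 + s • p.2)
      (-s • p.1 + c • p.2)) * (gw p.1 * gw p.2)) =
      ∫ p : E × E, F (c • p.1 - s • p.2) * (fderiv ℝ F p.1 p.2) * (gw p.1 * gw p.2) := by
    rw [← rot_integral c s hcs (fun p => F p.1 * (fderiv ℝ F (c • p.1 + s • p.2)
      (-s • p.1 + c • p.2)))]
    refine integral_congr_ae (Eventually.of_forall fun p => ?_)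
    simp only
    have a1 : c • (c • p.1 - s • p.2) + s • (s • p.1 + c • p.2) = p.1 := by
      have : p.1 = (c ^ 2 + s ^ 2) • p.1 := by rw [hcs, one_smul]
      conv_rhs => rw [this]
      module
    have a2 : -s • (c • p.1 - s • p.2) + c • (s • p.1 + c • p.2) = p.2 := by
      have : p.2 = (c ^ 2 + s ^ 2) • p.2 := by rw [hcs, one_smul]
      conv_rhs => rw [this]
      module
    rw [a1, a2]
  have i1 : Integrable (fun p : E × E => F (c • p.1 - s • p.2) * (fderiv ℝ F p.1 p.2) * (gw p.1 * gw p.2)) := by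
    refine gw_prod_int (M := M * M) (Continuous.aestronglyMeasurable
      ((hcF.comp (by fun_prop)).mul ((hcF'.comp continuous_fst).clm_apply continuous_snd))) fun p => ?_
    rw [abs_mul]
    have : |fderiv ℝ F p.1 p.2| ≤ M * ‖p.2‖ :=
      ((fderiv ℝ F p.1).le_opNorm p.2).trans (by gcongr; exact hM' _)
    calc _ ≤ M * (M * ‖p.2‖) := mul_le_mul (hM _) this (abs_nonneg _) hM0
      _ ≤ M * (M * ((1 + ‖p.1‖) * (1 + ‖p.2‖))) := by
        gcongr
        nlinarith [norm_nonneg p.1, norm_nonneg p.2, mul_nonneg (norm_nonneg p.1) (norm_nonneg p.2)]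
      _ = _ := by ring
  have i2 : Integrable (fun p : E × E => (fderiv ℝ F (c • p.1 - s • p.2) (gradient F p.1)) * (gw p.1 * gw p.2)) := by
    refine gw_prod_int (M := M * M) (Continuous.aestronglyMeasurable
      ((hcF'.comp (by fun_prop)).clm_apply (hcg.comp continuous_fst))) fun p => ?_
    have : |fderiv ℝ F (c • p.1 - s • p.2) (gradient F p.1)| ≤ M * M :=
      ((fderiv ℝ F _).le_opNorm _).trans (mul_le_mul (hM' _) ((hgn _).trans_le (hM' _)) (norm_nonneg _) hM0)
    calc _ ≤ M * M * (1 * 1) := by simpa using this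
      _ ≤ _ := by gcongr <;> linarith [norm_nonneg p.1, norm_nonneg p.2]
  have e2 : (∫ p : E × E, F (c • p.1 - s • p.2) * (fderiv ℝ F p.1 p.2) * (gw p.1 * gw p.2)) =
      -s * ∫ p : E × E, (fderiv ℝ F (c • p.1 - s • p.2) (gradient F p.1)) * (gw p.1 * gw p.2) := by
    rw [Measure.volume_eq_prod] at i1 i2 ⊢
    rw [integral_prod _ i1, integral_prod _ i2, ← integral_const_mul]
    refine integral_congr_ae (Eventually.of_forall fun x => ?_)
    simp only
    have hd : ∀ y, HasFDerivAt (fun y => F (c • x - s • y))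
        ((fderiv ℝ F (c • x - s • y)).comp (-(s • ContinuousLinearMap.id ℝ E))) y := by
      intro y
      have := (((hasFDerivAt_id (𝕜 := ℝ) y).const_smul s).const_sub (c • x))
      exact (((hF.differentiable (by norm_num)) _).hasFDerivAt).comp y this
    have hs1 : |s| ≤ 1 := Real.abs_sin_le_one t
    have := stein (H := fun y => F (c • x - s • y)) (M := M) (hF.comp (by fun_prop)) (fun y => hM _) (fun y => by
      rw [(hd y).fderiv]
      refine (ContinuousLinearMap.opNorm_comp_le _ _).trans ?_
      have : ‖-(s • ContinuousLinearMap.id ℝ E)‖ ≤ 1 := by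
        rw [norm_neg, norm_smul]
        have := ContinuousLinearMap.norm_id_le (𝕜 := ℝ) (E := E)
        have := norm_nonneg s
        calc _ ≤ (1:ℝ) * 1 := by gcongr; exact hs1
          _ = 1 := by norm_num
      calc _ ≤ M * 1 := mul_le_mul (hM' _) this (norm_nonneg _) hM0
        _ = M := mul_one _) (gradient F x)
    calc ∫ y, F (c • x - s • y) * (fderiv ℝ F x y) * (gw x * gw y)
        = gw x * ∫ y, F (c • x - s • y) * ⟪gradient F x, y⟫ * gw y := by
          rw [← integral_const_mul]
          refine integral_congr_ae (Eventually.of_forall fun y => ?_)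
          simp only [hgrad]; ring
      _ = _ := by
          rw [this, ← integral_const_mul, ← integral_const_mul]
          refine integral_congr_ae (Eventually.of_forall fun y => ?_)
          simp only [(hd y).fderiv]
          simp
          ring
  have i3 : Integrable (fun p : E × E => (‖fderiv ℝ F (c • p.1 - s • p.2)‖ ^ 2) * (gw p.1 * gw p.2)) := by
    refine gw_prod_int (M := M ^ 2) (Continuous.aestronglyMeasurable
      ((hcF'.comp (by fun_prop)).norm.pow 2)) fun p => ?_
    rw [abs_of_nonneg (by positivity)]
    calc _ ≤ M ^ 2 * (1 * 1) := by rw [one_mul, mul_one]; gcongr; exact hM' _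
      _ ≤ _ := by gcongr <;> linarith [norm_nonneg p.1, norm_nonneg p.2]
  have i4 : Integrable (fun p : E × E => (‖fderiv ℝ F p.1‖ ^ 2) * (gw p.1 * gw p.2)) := by
    refine gw_prod_int (M := M ^ 2) (Continuous.aestronglyMeasurable
      ((hcF'.comp (by fun_prop)).norm.pow 2)) fun p => ?_
    rw [abs_of_nonneg (by positivity)]
    calc _ ≤ M ^ 2 * (1 * 1) := by rw [one_mul, mul_one]; gcongr; exact hM' _
      _ ≤ _ := by gcongr <;> linarith [norm_nonneg p.1, norm_nonneg p.2]
  have e4 : ∫ p : E × E, (‖fderiv ℝ F p.1‖ ^ 2) * (gw p.1 * gw p.2) =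
      (∫ x : E, ‖fderiv ℝ F x‖ ^ 2 * gw x) * ∫ x : E, gw x := by
    rw [Measure.volume_eq_prod, ← integral_prod_mul]
    refine integral_congr_ae (Eventually.of_forall fun y => ?_)
    simp only; ring
  have e3 : ∫ p : E × E, (‖fderiv ℝ F (c • p.1 - s • p.2)‖ ^ 2) * (gw p.1 * gw p.2) =
      (∫ x : E, ‖fderiv ℝ F x‖ ^ 2 * gw x) * ∫ x : E, gw x := by
    rw [← e4, ← rot_integral c s hcs (fun p => ‖fderiv ℝ F p.1‖ ^ 2)]
  rw [e1, e2, neg_mul, neg_le_neg_iff]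
  refine mul_le_mul_of_nonneg_left ?_ ht
  have hle : ∫ p : E × E, (fderiv ℝ F (c • p.1 - s • p.2) (gradient F p.1)) * (gw p.1 * gw p.2) ≤
      ∫ p : E × E, (1/2) * ((‖fderiv ℝ F (c • p.1 - s • p.2)‖ ^ 2) * (gw p.1 * gw p.2)) +
        (1/2) * ((‖fderiv ℝ F p.1‖ ^ 2) * (gw p.1 * gw p.2)) := by
    refine integral_mono i2 ((i3.const_mul _).add (i4.const_mul _)) fun p => ?_
    simp only
    have h1 : fderiv ℝ F (c • p.1 - s • p.2) (gradient F p.1) ≤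
        ‖fderiv ℝ F (c • p.1 - s • p.2)‖ * ‖fderiv ℝ F p.1‖ := by
      rw [← hgn p.1]
      exact (Real.le_norm_self _).trans (ContinuousLinearMap.le_opNorm _ _)
    have h2 := mul_pos (gw_pos p.1) (gw_pos p.2)
    nlinarith [sq_nonneg (‖fderiv ℝ F (c • p.1 - s • p.2)‖ - ‖fderiv ℝ F p.1‖)]
  rw [integral_add (i3.const_mul _) (i4.const_mul _), integral_const_mul, integral_const_mul, e3, e4] at hle
  linarith

/-- Gaussian Poincaré inequality (mean zero, compactly supported case). -/
lemma gauss_poincare [Nontrivial E] {F : E → ℝ} (hF : ContDiff ℝ 1 F) (hc : HasCompactSupport F)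
    (h0 : ∫ x, F x * gw x = 0) :
    ∫ x, F x ^ 2 * gw x ≤ ∫ x, ‖fderiv ℝ F x‖ ^ 2 * gw x := by
  set G := (∫ x : E, ‖fderiv ℝ F x‖ ^ 2 * gw x)
  set Z := ∫ x : E, gw x
  have hgi : Integrable (gw : E → ℝ) := by
    refine (gw_int (E := E)).mono' gw_cont.aestronglyMeasurable (Eventually.of_forall fun y => ?_)
    have := gw_pos y
    rw [Real.norm_of_nonneg this.le]
    nlinarith [norm_nonneg y]
  have hZ : 0 < Z := by
    have := integral_pos_iff_support_of_nonneg (fun x : E => (gw_pos x).le) hgi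
    rw [this]
    have : Function.support (gw : E → ℝ) = univ := by ext x; simp [(gw_pos x).ne']
    rw [this]; simp
  let ψ : ℝ → ℝ := fun t => ouc F t - Real.cos t * (G * Z)
  have hd : ∀ t, HasDerivAt ψ ((∫ p : E × E, F p.1 * (fderiv ℝ F (Real.cos t • p.1 + Real.sin t • p.2)
      (-Real.sin t • p.1 + Real.cos t • p.2)) * (gw p.1 * gw p.2)) - -Real.sin t * (G * Z)) t := fun t =>
    (ouc_deriv hF hc t).sub ((Real.hasDerivAt_cos t).mul_const _)
  have hmono : MonotoneOn ψ (Icc 0 (Real.pi / 2)) := by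
    refine monotoneOn_of_deriv_nonneg (convex_Icc _ _) (fun t _ => (hd t).continuousAt.continuousWithinAt)
      (fun t _ => (hd t).differentiableAt.differentiableWithinAt) fun t ht => ?_
    rw [(hd t).deriv]
    rw [interior_Icc] at ht
    have hs : 0 ≤ Real.sin t := Real.sin_nonneg_of_nonneg_of_le_pi ht.1.le (by linarith [ht.2, Real.pi_pos])
    have := ouc_deriv_ge hF hc t hs
    linarith
  have hp := Real.pi_pos
  have := hmono (left_mem_Icc.2 (by positivity)) (right_mem_Icc.2 (by positivity)) (by positivity : (0:ℝ) ≤ Real.pi / 2)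
  have a0 : ouc F 0 = (∫ x, F x ^ 2 * gw x) * Z := by
    unfold ouc
    rw [Measure.volume_eq_prod, ← integral_prod_mul]
    refine integral_congr_ae (Eventually.of_forall fun y => ?_)
    simp; ring
  have a1 : ouc F (Real.pi / 2) = 0 := by
    unfold ouc
    have : (∫ x, F x * gw x) * (∫ x, F x * gw x) = 0 := by rw [h0]; simp
    rw [← this, Measure.volume_eq_prod, ← integral_prod_mul]
    refine integral_congr_ae (Eventually.of_forall fun y => ?_)
    simp; ring
  simp only [ψ, a0, a1, Real.cos_zero, Real.cos_pi_div_two] at this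
  nlinarith
end gauss
end

open MeasureTheory Metric Set Filter
open scoped RealInnerProductSpace
set_option linter.unusedSectionVars false
noncomputable section

section polar
variable {n : ℕ}

local notation "𝔼" => EuclideanSpace ℝ (Fin n)

lemma nontriv (hn : 2 ≤ n) : Nontrivial (EuclideanSpace ℝ (Fin n)) := by
  have : Nonempty (Fin n) := ⟨⟨0, by omega⟩⟩
  infer_instance

lemma int_vip (m : ℕ) (a : ℝ → ℝ) :
    ∫ r : Ioi (0:ℝ), a r ∂(Measure.volumeIoiPow m) = ∫ r in Ioi (0:ℝ), r ^ m * a r := by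
  simp only [Measure.volumeIoiPow, ENNReal.ofReal]
  rw [integral_withDensity_eq_integral_smul,
    integral_subtype_comap measurableSet_Ioi fun r ↦ Real.toNNReal (r ^ m) • a r,
    setIntegral_congr_fun measurableSet_Ioi fun x hx ↦ ?_]
  · rw [NNReal.smul_def, Real.coe_toNNReal _ (pow_nonneg (mem_Ioi.1 hx).le _)]; rfl
  · exact (measurable_subtype_coe.pow_const _).real_toNNReal

lemma sph_map (b : 𝔼 → ℝ) : ∫ σ, b σ ∂(sphMeasure n) =
    ∫ σ : sphere (0 : 𝔼) 1, b σ ∂((volume : Measure 𝔼).toSphere) := by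
  unfold sphMeasure
  exact (MeasurableEmbedding.subtype_coe (isClosed_sphere.measurableSet)).integral_map b

lemma polar_eq (hn : n ≠ 0) (g : 𝔼 → ℝ) :
    ∫ x, g x = ∫ p, g ((p.2 : ℝ) • (p.1 : 𝔼)) ∂((volume : Measure 𝔼).toSphere.prod (Measure.volumeIoiPow (n - 1))) := by
  have : Nonempty (Fin n) := ⟨⟨0, by omega⟩⟩
  have h1 : ∫ x, g x = ∫ x : ({(0)}ᶜ : Set 𝔼), g x ∂(volume.comap Subtype.val) := by
    rw [integral_subtype_comap (measurableSet_singleton _).compl g,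
        restrict_compl_singleton]
  have h2 := (volume : Measure 𝔼).measurePreserving_homeomorphUnitSphereProd.integral_comp
        (Homeomorph.measurableEmbedding _) (fun p => g ((p.2 : ℝ) • (p.1 : 𝔼)))
  rw [h1]
  rw [finrank_euclideanSpace_fin] at h2
  rw [← h2]
  refine integral_congr_ae (Eventually.of_forall fun x => ?_)
  have hx : ‖(x : 𝔼)‖ ≠ 0 := norm_ne_zero_iff.2 x.2
  simp [smul_smul, hx]

lemma polar_int (hn : n ≠ 0) {g : 𝔼 → ℝ} (hg : Integrable g) :
    Integrable (fun p : sphere (0 : 𝔼) 1 × Ioi (0:ℝ) => g ((p.2 : ℝ) • (p.1 : 𝔼)))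
      ((volume : Measure 𝔼).toSphere.prod (Measure.volumeIoiPow (n - 1))) := by
  have : Nonempty (Fin n) := ⟨⟨0, by omega⟩⟩
  have h2 := (volume : Measure 𝔼).measurePreserving_homeomorphUnitSphereProd.integrable_comp_emb
        (Homeomorph.measurableEmbedding _) (g := fun p => g ((p.2 : ℝ) • (p.1 : 𝔼)))
  rw [finrank_euclideanSpace_fin] at h2
  rw [← h2]
  have h3 : Integrable (fun x : ({(0)}ᶜ : Set 𝔼) => g x) (volume.comap Subtype.val) := by
    have := (integrableOn_iff_comap_subtypeVal (μ := (volume : Measure 𝔼)) (f := g) (measurableSet_singleton (0:𝔼)).compl).1 hg.integrableOn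
    exact this
  refine h3.congr (Eventually.of_forall fun x => ?_)
  have hx : ‖(x : 𝔼)‖ ≠ 0 := norm_ne_zero_iff.2 x.2
  simp [smul_smul, hx]

lemma polar_nonneg (hn : n ≠ 0) {g : 𝔼 → ℝ} (hg : Integrable g)
    (h : ∀ r : ℝ, 0 < r → 0 ≤ ∫ σ, g (r • σ) ∂(sphMeasure n)) : 0 ≤ ∫ x, g x := by
  rw [polar_eq hn, integral_prod_symm _ (polar_int hn hg)]
  refine integral_nonneg fun r => ?_
  have := h r r.2
  rw [sph_map] at this
  exact this

lemma polar_prod (hn : n ≠ 0) (a : ℝ → ℝ) (b : 𝔼 → ℝ) :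
    ∫ x : 𝔼, a ‖x‖ * b (‖x‖⁻¹ • x) =
      (∫ σ, b σ ∂(sphMeasure n)) * ∫ r in Ioi (0:ℝ), r ^ (n - 1) * a r := by
  rw [polar_eq hn, sph_map, ← int_vip, ← integral_prod_mul]
  refine integral_congr_ae (Eventually.of_forall fun p => ?_)
  have h1 : ‖(p.1 : 𝔼)‖ = 1 := by simp
  have h2 : (0:ℝ) < p.2 := p.2.2
  simp only [norm_smul, h1, Real.norm_of_nonneg h2.le, mul_one, smul_smul]
  rw [inv_mul_cancel₀ h2.ne', one_smul, mul_comm]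

end polar

section div
variable {n : ℕ}
local notation "𝔼" => EuclideanSpace ℝ (Fin n)

lemma ccint {g : 𝔼 → ℝ} (hg : Continuous g) (hc : HasCompactSupport g) : Integrable g :=
  hg.integrable_of_hasCompactSupport hc

lemma ibp {f g : 𝔼 → ℝ} (hf : ContDiff ℝ 1 f) (hg : ContDiff ℝ 1 g) (hc : HasCompactSupport f) (v : 𝔼) :
    ∫ x, f x * fderiv ℝ g x v = - ∫ x, fderiv ℝ f x v * g x := by
  have h1 : Continuous fun x => fderiv ℝ f x v := (hf.continuous_fderiv (by norm_num)).clm_apply continuous_const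
  have h2 : Continuous fun x => fderiv ℝ g x v := (hg.continuous_fderiv (by norm_num)).clm_apply continuous_const
  have hc' : HasCompactSupport fun x => fderiv ℝ f x v := hc.fderiv_apply (𝕜 := ℝ) v
  exact integral_mul_fderiv_eq_neg_fderiv_mul_of_integrable
    (ccint (h1.mul hg.continuous) hc'.mul_right) (ccint (hf.continuous.mul h2) hc.mul_right)
    (ccint (hf.continuous.mul hg.continuous) hc.mul_right)
    (fun x _ => hf.differentiable (by norm_num) x) (fun x _ => hg.differentiable (by norm_num) x)

/-- radial derivative -/
def DD (f : 𝔼 → ℝ) (x : 𝔼) : ℝ := fderiv ℝ f x x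

lemma sum_single (x : 𝔼) : ∑ i, x i • EuclideanSpace.single i (1:ℝ) = x := by
  have := (EuclideanSpace.basisFun (Fin n) ℝ).sum_repr x
  simpa using this

lemma DD_eq (f : 𝔼 → ℝ) (x : 𝔼) :
    DD f x = ∑ i, x i * fderiv ℝ f x (EuclideanSpace.single i 1) := by
  unfold DD
  conv_lhs => rw [← sum_single x]
  rw [map_sum]
  simp [sum_single]

lemma DD_cont {f : 𝔼 → ℝ} (hf : ContDiff ℝ 1 f) : Continuous (DD f) :=
  (hf.continuous_fderiv (by norm_num)).clm_apply continuous_id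

lemma DD_supp {f : 𝔼 → ℝ} (hc : HasCompactSupport f) : HasCompactSupport (DD f) := by
  refine (hc.fderiv (𝕜 := ℝ)).mono ?_
  intro x hx
  simp only [DD, Function.mem_support] at hx ⊢
  intro h; rw [h] at hx; simp at hx

lemma int_DD {f : 𝔼 → ℝ} (hf : ContDiff ℝ 1 f) (hc : HasCompactSupport f) :
    ∫ x, DD f x = - (n : ℝ) * ∫ x, f x := by
  have hi : ∀ i : Fin n, ∫ x : 𝔼, x i * fderiv ℝ f x (EuclideanSpace.single i 1) = - ∫ x, f x := by
    intro i
    have hp : ContDiff ℝ 1 (fun x : 𝔼 => x i) := by fun_prop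
    have hfd : ∀ x : 𝔼, fderiv ℝ (fun x : 𝔼 => x i) x (EuclideanSpace.single i 1) = 1 := by
      intro x
      have : HasFDerivAt (fun x : 𝔼 => x i) (EuclideanSpace.proj (𝕜 := ℝ) i : 𝔼 →L[ℝ] ℝ) x :=
        (EuclideanSpace.proj (𝕜 := ℝ) i : 𝔼 →L[ℝ] ℝ).hasFDerivAt
      rw [this.fderiv]; simp
    have := ibp hf hp hc (EuclideanSpace.single i 1)
    simp only [hfd, mul_one] at this
    rw [this, neg_neg]
    congr 1; ext x; ring
  have hcf : ∀ i : Fin n, Integrable (fun x : 𝔼 => x i * fderiv ℝ f x (EuclideanSpace.single i 1)) := by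
    intro i
    refine ccint ?_ (HasCompactSupport.mul_left (hc.fderiv_apply (𝕜 := ℝ) _))
    exact (by fun_prop : Continuous fun x : 𝔼 => x i).mul
      ((hf.continuous_fderiv (by norm_num)).clm_apply continuous_const)
  simp only [DD_eq]
  rw [integral_finsetSum _ (fun i _ => hcf i)]
  simp [hi]

lemma DD_mul {f g : 𝔼 → ℝ} {x : 𝔼} (hf : DifferentiableAt ℝ f x) (hg : DifferentiableAt ℝ g x) :
    DD (fun x => f x * g x) x = f x * DD g x + g x * DD f x := by
  unfold DD
  rw [fderiv_fun_mul hf hg]; simp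

lemma int_mul_DD {f : 𝔼 → ℝ} (hf : ContDiff ℝ 1 f) (hc : HasCompactSupport f) :
    ∫ x, f x * DD f x = - ((n : ℝ) / 2) * ∫ x, f x ^ 2 := by
  have h := int_DD (hf.mul hf) hc.mul_right
  have hd := hf.differentiable (by norm_num)
  have e : ∀ x, DD (fun x => f x * f x) x = 2 * (f x * DD f x) := fun x => by
    rw [DD_mul (hd x) (hd x)]; ring
  simp only [e] at h
  rw [integral_const_mul] at h
  simp only [← pow_two] at h
  linarith

lemma int_lin3 {f g h : 𝔼 → ℝ} (hf : Integrable f) (hg : Integrable g) (hh : Integrable h) (a b c : ℝ) :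
    ∫ x, (a * f x + b * g x + c * h x) = a * (∫ x, f x) + b * (∫ x, g x) + c * (∫ x, h x) := by
  have h1 : Integrable (fun x => a * f x + b * g x) := (hf.const_mul a).add (hg.const_mul b)
  rw [integral_add h1 (hh.const_mul c), integral_add (hf.const_mul a) (hg.const_mul b),
    integral_const_mul, integral_const_mul, integral_const_mul]

lemma hardy {f : 𝔼 → ℝ} (hf : ContDiff ℝ 1 f) (hc : HasCompactSupport f) :
    ((n : ℝ) / 2) ^ 2 * ∫ x, f x ^ 2 ≤ ∫ x, DD f x ^ 2 := by
  have h := int_mul_DD hf hc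
  have i1 : Integrable fun x => f x * DD f x := ccint (hf.continuous.mul (DD_cont hf)) hc.mul_right
  have i2 : Integrable fun x => f x ^ 2 := ccint (hf.continuous.pow 2) (by simp only [pow_two]; exact hc.mul_right)
  have i3 : Integrable fun x => DD f x ^ 2 := ccint ((DD_cont hf).pow 2) (by simp only [pow_two]; exact (DD_supp hc).mul_right)
  have h0 : 0 ≤ ∫ x, (DD f x + ((n : ℝ) / 2) * f x) ^ 2 := integral_nonneg fun x => sq_nonneg _
  have e : ∀ x, (DD f x + ((n : ℝ) / 2) * f x) ^ 2 = 1 * DD f x ^ 2 + (n : ℝ) * (f x * DD f x) + ((n : ℝ) / 2) ^ 2 * f x ^ 2 :=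
    fun x => by ring
  simp only [e] at h0
  rw [int_lin3 i3 i1 i2, h] at h0
  nlinarith
end div
end

open MeasureTheory Metric Set Filter
open scoped RealInnerProductSpace Topology
set_option linter.unusedSectionVars false
noncomputable section

section cut
variable {n : ℕ}
local notation "𝔼" => EuclideanSpace ℝ (Fin n)

/-- `C^k` functions with compact support away from the origin. -/
def Adm (k : ℕ) (f : 𝔼 → ℝ) : Prop :=
  ContDiff ℝ k f ∧ HasCompactSupport f ∧ tsupport f ⊆ {(0 : 𝔼)}ᶜ

lemma adm_of {k : ℕ} {f : 𝔼 → ℝ} (h : ∀ x, x ≠ 0 → ContDiffAt ℝ k f x) {K : Set 𝔼} (hK : IsCompact K)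
    (h0 : (0 : 𝔼) ∉ K) (hs : Function.support f ⊆ K) : Adm k f := by
  have ht : tsupport f ⊆ K := closure_minimal hs hK.isClosed
  refine ⟨?_, HasCompactSupport.of_support_subset_isCompact hK hs, fun x hx hx0 => ?_⟩
  · rw [contDiff_iff_contDiffAt]
    intro x
    by_cases hx : x = 0
    · have : x ∉ tsupport f := fun hh => h0 (hx ▸ ht hh)
      have := notMem_tsupport_iff_eventuallyEq.1 this
      exact contDiffAt_const.congr_of_eventuallyEq this
    · exact h x hx
  · rw [mem_singleton_iff] at hx0
    exact h0 (hx0 ▸ ht hx)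

lemma Adm.mul {k : ℕ} {f w : 𝔼 → ℝ} (hf : Adm k f) (hw : ∀ x, x ≠ 0 → ContDiffAt ℝ k w x) :
    Adm k (fun x => f x * w x) := by
  refine adm_of (K := tsupport f) (fun x hx => hf.1.contDiffAt.mul (hw x hx)) hf.2.1
    (fun h => hf.2.2 h rfl) ?_
  intro x hx
  refine subset_tsupport f ?_
  simp only [Function.mem_support] at hx ⊢
  intro h; rw [h] at hx; simp at hx

lemma Adm.of_le {k l : ℕ} (h : l ≤ k) {f : 𝔼 → ℝ} (hf : Adm k f) : Adm l f :=
  ⟨hf.1.of_le (by exact_mod_cast h), hf.2⟩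

lemma Adm.integrable {k : ℕ} {f : 𝔼 → ℝ} (hf : Adm k f) : Integrable f := ccint hf.1.continuous hf.2.1

lemma Adm.zero {k : ℕ} {f : 𝔼 → ℝ} (hf : Adm k f) : f 0 = 0 :=
  image_eq_zero_of_notMem_tsupport fun h => hf.2.2 h rfl

lemma norm_cd {k : ℕ} {x : 𝔼} (hx : x ≠ 0) : ContDiffAt ℝ k (fun x : 𝔼 => ‖x‖) x := contDiffAt_norm ℝ hx

lemma norm_fd {x : 𝔼} (hx : x ≠ 0) : HasFDerivAt (fun x : 𝔼 => ‖x‖) (‖x‖⁻¹ • innerSL ℝ x) x := by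
  have h := (hasStrictFDerivAt_norm_sq x).hasFDerivAt
  have hx' : ‖x‖ ≠ 0 := norm_ne_zero_iff.2 hx
  have h2 := h.sqrt (by positivity)
  simp only [Real.sqrt_sq (norm_nonneg _)] at h2
  refine h2.congr_fderiv ?_
  ext y
  simp
  field_simp

/-- cutoff in `log |x|`. -/
def cut (η : ℝ → ℝ) (x : 𝔼) : ℝ := if x = 0 then 0 else η (Real.log ‖x‖)

lemma cut_adm {k : ℕ} {η : ℝ → ℝ} (hη : ContDiff ℝ k η) (hc : HasCompactSupport η) : Adm k (cut η : 𝔼 → ℝ) := by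
  obtain ⟨B, hB⟩ := hc.isCompact.isBounded.exists_norm_le
  refine adm_of (K := closedBall (0 : 𝔼) (Real.exp B) \ ball 0 (Real.exp (-B))) ?_ ?_ ?_ ?_
  · intro x hx
    have hx' : ‖x‖ ≠ 0 := norm_ne_zero_iff.2 hx
    have : ContDiffAt ℝ k (fun x : 𝔼 => η (Real.log ‖x‖)) x :=
      hη.contDiffAt.comp x ((norm_cd hx).log hx')
    refine this.congr_of_eventuallyEq ?_
    filter_upwards [isOpen_ne.mem_nhds hx] with y hy
    simp only [cut, if_neg (show y ≠ 0 from hy)]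
  · exact (isCompact_closedBall _ _).diff isOpen_ball
  · simp [Real.exp_pos]
  · intro x hx
    simp only [cut, Function.mem_support, ne_eq, ite_eq_left_iff, not_forall] at hx
    obtain ⟨hx0, h2⟩ := hx
    have hpos : 0 < ‖x‖ := norm_pos_iff.2 hx0
    have := hB _ (subset_tsupport η h2)
    rw [Real.norm_eq_abs, abs_le] at this
    simp only [Set.mem_sdiff, mem_closedBall_zero_iff, mem_ball_zero_iff, not_lt]
    rw [← Real.exp_log hpos]
    exact ⟨Real.exp_le_exp.2 this.2, Real.exp_le_exp.2 this.1⟩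

lemma cut_fd {η : ℝ → ℝ} (hη : ContDiff ℝ 1 η) {x : 𝔼} (hx : x ≠ 0) :
    HasFDerivAt (cut η) ((cut (deriv η) x * (‖x‖ ^ 2)⁻¹) • innerSL ℝ x) x := by
  have hx' : ‖x‖ ≠ 0 := norm_ne_zero_iff.2 hx
  have h1 := (norm_fd hx).log hx'
  have h2 := ((hη.differentiable (by norm_num)) (Real.log ‖x‖)).hasDerivAt.comp_hasFDerivAt x h1
  have h4 : (cut η : 𝔼 → ℝ) =ᶠ[𝓝 x] (η ∘ fun x : 𝔼 => Real.log ‖x‖) := by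
    filter_upwards [isOpen_ne.mem_nhds hx] with y hy
    simp only [cut, if_neg (show y ≠ 0 from hy), Function.comp]
  have h3 := h2.congr_of_eventuallyEq h4
  refine h3.congr_fderiv ?_
  ext y
  simp [cut, hx]
  field_simp

lemma cut_DD {η : ℝ → ℝ} (hη : ContDiff ℝ 1 η) (x : 𝔼) : DD (cut η) x = cut (deriv η) x := by
  by_cases hx : x = 0
  · simp [DD, hx, cut]
  · have hx' : ‖x‖ ≠ 0 := norm_ne_zero_iff.2 hx
    rw [DD, (cut_fd hη hx).fderiv]
    simp
    field_simp

lemma innerSL_dual (x : 𝔼) : innerSL ℝ x = InnerProductSpace.toDual ℝ 𝔼 x := by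
  ext y; simp

lemma dual_orth (L : 𝔼 →L[ℝ] ℝ) (x : 𝔼) (a b : ℝ) (h : L x = 0) :
    ‖a • innerSL ℝ x + b • L‖ ^ 2 = a ^ 2 * ‖x‖ ^ 2 + b ^ 2 * ‖L‖ ^ 2 := by
  obtain ⟨g, rfl⟩ := (InnerProductSpace.toDual ℝ 𝔼).surjective L
  have hg : ⟪x, g⟫ = 0 := by rw [real_inner_comm]; simpa using h
  rw [innerSL_dual, ← map_smul, ← map_smul, ← map_add, LinearIsometryEquiv.norm_map, LinearIsometryEquiv.norm_map,
    norm_add_sq_real, inner_smul_left, inner_smul_right, hg]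
  simp [norm_smul, mul_pow]

lemma dual_proj (L : 𝔼 →L[ℝ] ℝ) (x : 𝔼) (h : ‖x‖ = 1) :
    ‖L - (L x) • innerSL ℝ x‖ ^ 2 = ‖L‖ ^ 2 - (L x) ^ 2 := by
  obtain ⟨g, rfl⟩ := (InnerProductSpace.toDual ℝ 𝔼).surjective L
  have hg : InnerProductSpace.toDual ℝ 𝔼 g x = ⟪g, x⟫ := by simp
  rw [hg, innerSL_dual, ← map_smul, ← map_sub, LinearIsometryEquiv.norm_map, LinearIsometryEquiv.norm_map,
    norm_sub_sq_real, inner_smul_right, norm_smul, h]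
  simp
  ring

/-- `r`-spherical trace extended `0`-homogeneously -/
def hom (φ : 𝔼 → ℝ) (r : ℝ) (x : 𝔼) : ℝ := φ (r • (‖x‖⁻¹ • x))

/-- tangential energy density on the unit sphere. -/
def tang (φ : 𝔼 → ℝ) (r : ℝ) (σ : 𝔼) : ℝ :=
  r ^ 2 * (‖fderiv ℝ φ (r • σ)‖ ^ 2 - (fderiv ℝ φ (r • σ) σ) ^ 2)

lemma dir_cd {k : ℕ} {x : 𝔼} (hx : x ≠ 0) : ContDiffAt ℝ k (fun x : 𝔼 => ‖x‖⁻¹ • x) x :=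
  ((norm_cd hx).inv (norm_ne_zero_iff.2 hx)).smul contDiffAt_id

lemma hom_cd {k : ℕ} {φ : 𝔼 → ℝ} (hφ : ContDiff ℝ k φ) (r : ℝ) {x : 𝔼} (hx : x ≠ 0) :
    ContDiffAt ℝ k (hom φ r) x :=
  hφ.contDiffAt.comp x ((dir_cd hx).const_smul r)

lemma hom_fd {φ : 𝔼 → ℝ} (hφ : ContDiff ℝ 1 φ) (r : ℝ) {x : 𝔼} (hx : x ≠ 0) :
    HasFDerivAt (hom φ r) ((r * ‖x‖⁻¹) • (fderiv ℝ φ (r • (‖x‖⁻¹ • x)) -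
      (fderiv ℝ φ (r • (‖x‖⁻¹ • x)) (‖x‖⁻¹ • x)) • innerSL ℝ (‖x‖⁻¹ • x))) x := by
  have hx' : ‖x‖ ≠ 0 := norm_ne_zero_iff.2 hx
  have h1 := (((hasDerivAt_inv hx').comp_hasFDerivAt x (norm_fd hx)).smul (hasFDerivAt_id x)).const_smul r
  have h2 := ((hφ.differentiable (by norm_num)) (r • (‖x‖⁻¹ • x))).hasFDerivAt.comp x h1
  refine h2.congr_fderiv ?_
  ext y
  simp
  field_simp
  ring

lemma hom_DD {φ : 𝔼 → ℝ} (hφ : ContDiff ℝ 1 φ) (r : ℝ) {x : 𝔼} (hx : x ≠ 0) :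
    fderiv ℝ (hom φ r) x x = 0 := by
  have hx' : ‖x‖ ≠ 0 := norm_ne_zero_iff.2 hx
  rw [(hom_fd hφ r hx).fderiv]
  simp only [smul_apply, sub_apply, innerSL_apply_apply,
    inner_smul_left, real_inner_self_eq_norm_sq, map_smul, smul_eq_mul]
  simp
  right
  field_simp
  ring

lemma hom_norm {φ : 𝔼 → ℝ} (hφ : ContDiff ℝ 1 φ) (r : ℝ) {x : 𝔼} (hx : x ≠ 0) :
    ‖x‖ ^ 2 * ‖fderiv ℝ (hom φ r) x‖ ^ 2 = tang φ r (‖x‖⁻¹ • x) := by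
  have hx' : ‖x‖ ≠ 0 := norm_ne_zero_iff.2 hx
  rw [(hom_fd hφ r hx).fderiv, norm_smul, mul_pow, dual_proj, tang]
  · simp [mul_pow]
    field_simp
  · simp [norm_smul, hx']

lemma gw_cd {k : ℕ} : ContDiff ℝ k (gw : 𝔼 → ℝ) := by
  unfold gw
  exact (contDiff_const.mul (contDiff_norm_sq ℝ)).exp

lemma tang_cont {φ : 𝔼 → ℝ} (hφ : ContDiff ℝ 1 φ) (r : ℝ) : Continuous (tang φ r) := by
  have h : Continuous fun σ : 𝔼 => fderiv ℝ φ (r • σ) :=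
    (hφ.continuous_fderiv (by norm_num)).comp (continuous_const_smul r)
  unfold tang
  exact continuous_const.mul ((h.norm.pow 2).sub ((h.clm_apply continuous_id).pow 2))

lemma sp_aux (hn : 2 ≤ n) {φ : 𝔼 → ℝ} (hφ : ContDiff ℝ 1 φ) (r : ℝ)
    (h0 : (∫ σ, φ (r • σ) ∂(sphMeasure n)) = 0) {η : ℝ → ℝ} (hη : ContDiff ℝ 2 η) (hc : HasCompactSupport η) :
    ((n : ℝ) - 1) * ∫ x : 𝔼, cut η x ^ 2 * gw x * hom φ r x ^ 2 ≤
      (∫ x : 𝔼, cut η x ^ 2 * gw x * tang φ r (‖x‖⁻¹ • x)) + ∫ x : 𝔼, cut (deriv η) x ^ 2 * gw x * hom φ r x ^ 2 := by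
  have hnt := nontriv hn
  have hη1 : ContDiff ℝ 1 η := hη.of_le (by norm_num)
  have hη' : ContDiff ℝ 1 (deriv η) := by
    have : ContDiff ℝ (1 + 1) η := by simpa [one_add_one_eq_two] using hη
    exact (contDiff_succ_iff_deriv.1 this).2.2
  have hcA : Adm 1 (cut η : 𝔼 → ℝ) := cut_adm (by exact_mod_cast hη1) hc
  have hcA' : Adm 1 (cut (deriv η) : 𝔼 → ℝ) := cut_adm (by exact_mod_cast hη') hc.deriv
  have hh : ∀ x : 𝔼, x ≠ 0 → ContDiffAt ℝ (1:ℕ) (hom φ r) x := fun x hx => hom_cd (by exact_mod_cast hφ) r hx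
  have hg : ∀ x : 𝔼, x ≠ 0 → ContDiffAt ℝ (1:ℕ) (gw : 𝔼 → ℝ) x := fun x hx => gw_cd.contDiffAt
  have hρ : Adm 1 (fun x : 𝔼 => cut η x * ‖x‖) := hcA.mul (fun x hx => norm_cd hx)
  have hF : Adm 1 (fun x : 𝔼 => cut η x * ‖x‖ * hom φ r x) := hρ.mul hh
  set F : 𝔼 → ℝ := fun x : 𝔼 => cut η x * ‖x‖ * hom φ r x with hFdef
  have hF0 : ∫ x, F x * gw x = 0 := by
    have := polar_prod (n := n) (by omega) (fun r => (if r = 0 then 0 else η (Real.log r)) * r * Real.exp (-(1/2) * r ^ 2))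
      (fun σ => φ (r • σ))
    rw [h0, zero_mul] at this
    rw [← this]
    refine integral_congr_ae (Eventually.of_forall fun x => ?_)
    simp only [F, cut, hom, gw, norm_eq_zero]
    ring
  have hP := gauss_poincare hF.1 hF.2.1 hF0
  have hfd : ∀ x : 𝔼, ‖fderiv ℝ F x‖ ^ 2 * gw x = 1 * (cut η x ^ 2 * gw x * hom φ r x ^ 2 + cut η x ^ 2 * gw x * tang φ r (‖x‖⁻¹ • x))
      + 2 * (cut η x * cut (deriv η) x * gw x * hom φ r x ^ 2) + 1 * (cut (deriv η) x ^ 2 * gw x * hom φ r x ^ 2) := by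
    intro x
    by_cases hx : x = 0
    · have : fderiv ℝ F x = 0 := by
        have : x ∉ tsupport F := fun h => hF.2.2 h hx
        have h2 : x ∉ tsupport (fderiv ℝ F) := fun h => this (tsupport_fderiv_subset ℝ h)
        exact image_eq_zero_of_notMem_tsupport h2
      rw [this, hx]; simp [cut]
    · have hx' : ‖x‖ ≠ 0 := norm_ne_zero_iff.2 hx
      have h1 := ((cut_fd hη1 hx).mul (norm_fd hx)).mul ((hh x hx).differentiableAt (by norm_num)).hasFDerivAt
      have h2 : HasFDerivAt F ((hom φ r x * (cut (deriv η) x + cut η x) * ‖x‖⁻¹) • innerSL ℝ x +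
          (cut η x * ‖x‖) • fderiv ℝ (hom φ r) x) x := by
        refine h1.congr_fderiv ?_
        ext y
        simp
        field_simp
        ring
      rw [h2.fderiv, dual_orth _ _ _ _ (hom_DD hφ r hx), ← hom_norm hφ r hx]
      field_simp
      ring
  have iA : Adm 1 (fun x : 𝔼 => cut η x ^ 2 * gw x * hom φ r x ^ 2) := by
    have := ((hcA.mul (fun x _ => hcA.1.contDiffAt)).mul hg).mul (fun x hx => (hh x hx).pow 2)
    simpa only [pow_two] using this
  have iB : Adm 1 (fun x : 𝔼 => cut η x * cut (deriv η) x * gw x * hom φ r x ^ 2) :=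
    ((hcA.mul (fun x _ => hcA'.1.contDiffAt)).mul hg).mul (fun x hx => (hh x hx).pow 2)
  have iC : Adm 1 (fun x : 𝔼 => cut (deriv η) x ^ 2 * gw x * hom φ r x ^ 2) := by
    have := ((hcA'.mul (fun x _ => hcA'.1.contDiffAt)).mul hg).mul (fun x hx => (hh x hx).pow 2)
    simpa only [pow_two] using this
  have iD : Adm 0 (fun x : 𝔼 => cut η x ^ 2 * gw x * tang φ r (‖x‖⁻¹ • x)) := by
    have h1 : Adm 1 (fun x : 𝔼 => cut η x ^ 2 * gw x) := by
      have := ((hcA.mul (fun x _ => hcA.1.contDiffAt)).mul hg)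
      simpa only [pow_two] using this
    refine (h1.of_le (by norm_num : 0 ≤ 1)).mul fun x hx => ?_
    have hct : ContDiff ℝ (0:ℕ) (tang φ r) := by
      have := contDiff_zero (𝕜 := ℝ).2 (tang_cont hφ r)
      exact_mod_cast this
    exact hct.contDiffAt.comp x (dir_cd hx)
  simp only [hfd] at hP
  have iAD : Integrable (fun x : 𝔼 => cut η x ^ 2 * gw x * hom φ r x ^ 2 + cut η x ^ 2 * gw x * tang φ r (‖x‖⁻¹ • x)) :=
    iA.integrable.add iD.integrable
  rw [int_lin3 iAD iB.integrable iC.integrable, integral_add iA.integrable iD.integrable] at hP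
  have hdd := int_DD iA.1 iA.2.1
  have hF2 : Integrable (fun x => F x ^ 2 * gw x) := by
    have := ((hF.mul (fun x _ => hF.1.contDiffAt)).mul hg).integrable
    simpa only [pow_two] using this
  have hDD : ∀ x : 𝔼, DD (fun x : 𝔼 => cut η x ^ 2 * gw x * hom φ r x ^ 2) x =
      2 * (cut η x * cut (deriv η) x * gw x * hom φ r x ^ 2) + (-1) * (F x ^ 2 * gw x) + 0 * (F x ^ 2 * gw x) := by
    intro x
    by_cases hx : x = 0
    · rw [hx]; simp [DD, cut, F]
    · have d1 := (cut_fd hη1 hx).pow 2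
      have d2 := gw_hasFDerivAt x
      have d3 := (((hh x hx).differentiableAt (by norm_num)).hasFDerivAt).pow 2
      have d := (d1.mul d2).mul d3
      have d' : fderiv ℝ (fun x : 𝔼 => cut η x ^ 2 * gw x * hom φ r x ^ 2) x = _ := d.fderiv
      have hx' : ‖x‖ ≠ 0 := norm_ne_zero_iff.2 hx
      rw [DD, d']
      simp [hom_DD hφ r hx, F]
      field_simp
      ring
  simp only [hDD] at hdd
  rw [int_lin3 iB.integrable hF2 hF2] at hdd
  linarith

end cut
end

open MeasureTheory Metric Set Filter
open scoped RealInnerProductSpace Topology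
set_option linter.unusedSectionVars false
noncomputable section

/-- a fixed one dimensional bump -/
def bmp : ℝ → ℝ := (⟨1, 2, one_pos, one_lt_two⟩ : ContDiffBump (0:ℝ))

lemma bmp_cd {k : ℕ} : ContDiff ℝ k bmp := ContDiffBump.contDiff _
lemma bmp_cs : HasCompactSupport bmp := ContDiffBump.hasCompactSupport _
lemma bmp_one {s : ℝ} (h : |s| ≤ 1) : bmp s = 1 := by
  unfold bmp
  exact ContDiffBump.one_of_mem_closedBall _ (by simpa using h)

/-- the scaled bump -/
def bs (ε s : ℝ) : ℝ := bmp (ε * s)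

lemma bs_cd {k : ℕ} (ε : ℝ) : ContDiff ℝ k (bs ε) := bmp_cd.comp (contDiff_const.mul contDiff_id)
lemma bs_cs {ε : ℝ} (h : ε ≠ 0) : HasCompactSupport (bs ε) := 
  bmp_cs.comp_homeomorph (Homeomorph.mulLeft₀ ε h)
lemma bs_deriv (ε s : ℝ) : deriv (bs ε) s = ε * deriv bmp (ε * s) := by
  unfold bs
  simpa using deriv_comp_mul_left ε bmp s

lemma bmp_deriv_bdd : ∃ M, ∀ s, ‖deriv bmp s‖ ≤ M :=
  bmp_cs.deriv.exists_bound_of_continuous ((bmp_cd (k := 1)).continuous_deriv (by norm_num))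

section sp
variable {n : ℕ}
local notation "𝔼" => EuclideanSpace ℝ (Fin n)

/-- radial gaussian weight -/
def Wt (m : ℕ) (r : ℝ) : ℝ := r ^ m * Real.exp (-(1/2) * r ^ 2)

lemma Wt_int (m : ℕ) : IntegrableOn (Wt m) (Ioi 0) := by
  have := integrableOn_rpow_mul_exp_neg_mul_sq (b := 1/2) (by norm_num) (s := (m:ℝ)) (by
    have : (0:ℝ) ≤ m := by positivity
    linarith)
  unfold Wt
  simpa using this

lemma Wt_pos : ∀ m : ℕ, 0 < ∫ r in Ioc (1:ℝ) 2, Wt m r := by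
  intro m
  rw [← intervalIntegral.integral_of_le (by norm_num)]
  refine intervalIntegral.intervalIntegral_pos_of_pos_on ?_ ?_ (by norm_num)
  · apply Continuous.intervalIntegrable
    unfold Wt; fun_prop
  · intro x hx
    have : 0 < x := by linarith [hx.1]
    unfold Wt; positivity

lemma Wt_nonneg (m : ℕ) {r : ℝ} (h : 0 ≤ r) : 0 ≤ Wt m r := by unfold Wt; positivity

lemma cut_polar (hn : n ≠ 0) (η : ℝ → ℝ) (b : 𝔼 → ℝ) : ∫ x : 𝔼, cut η x ^ 2 * gw x * b (‖x‖⁻¹ • x) = 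
    (∫ σ, b σ ∂(sphMeasure n)) * ∫ r in Ioi (0:ℝ), η (Real.log r) ^ 2 * Wt (n-1) r := by
  have := polar_prod hn (fun r => (if r = 0 then 0 else η (Real.log r)) ^ 2 * Real.exp (-(1/2) * r ^ 2)) b
  refine Eq.trans ?_ (this.trans ?_)
  · congr 1; ext x; simp [cut, gw]
  · congr 1
    refine setIntegral_congr_fun measurableSet_Ioi fun r hr => ?_
    simp only [Wt, if_neg (ne_of_gt (mem_Ioi.1 hr))]
    ring

lemma eta_int {η : ℝ → ℝ} (hη : Continuous η) {M : ℝ} (hM : ∀ s, ‖η s‖ ≤ M) (m : ℕ) :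
    IntegrableOn (fun r => η (Real.log r) ^ 2 * Wt m r) (Ioi 0) := by
  refine Integrable.bdd_mul (c := M ^ 2) (Wt_int m) ?_ (Eventually.of_forall fun x => ?_)
  · exact ((hη.measurable.comp Real.measurable_log).pow_const 2).aestronglyMeasurable
  · rw [norm_pow]; gcongr; exact hM _

lemma sph_poinc (hn : 2 ≤ n) {φ : 𝔼 → ℝ} (hφ : ContDiff ℝ 1 φ) (r : ℝ)
    (h0 : (∫ σ, φ (r • σ) ∂(sphMeasure n)) = 0) :
    ((n : ℝ) - 1) * ∫ σ, φ (r • σ) ^ 2 ∂(sphMeasure n) ≤ ∫ σ, tang φ r σ ∂(sphMeasure n) := by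
  have hn0 : n ≠ 0 := by omega
  obtain ⟨M, hM⟩ := bmp_deriv_bdd
  have hM0 : 0 ≤ M := (norm_nonneg _).trans (hM 0)
  obtain ⟨M', hM'⟩ := bmp_cs.exists_bound_of_continuous (bmp_cd (k := 1)).continuous
  set S := ∫ σ, φ (r • σ) ^ 2 ∂(sphMeasure n) with hS
  set T := ∫ σ, tang φ r σ ∂(sphMeasure n) with hT
  set c0 := ∫ r in Ioc (1:ℝ) 2, Wt (n-1) r with hc0
  set I := ∫ r in Ioi (0:ℝ), Wt (n-1) r with hI
  have hS0 : 0 ≤ S := integral_nonneg fun σ => sq_nonneg _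
  have hc0p : 0 < c0 := Wt_pos _
  by_contra hcon
  push Not at hcon
  have key : ∀ ε : ℝ, 0 < ε → ε ≤ 1 → (((n : ℝ) - 1) * S - T) * c0 ≤ ε ^ 2 * (M ^ 2 * I * S) := by
    intro ε h1 h2
    have h := sp_aux hn hφ r h0 (bs_cd (k := 2) ε) (bs_cs h1.ne')
    have e1 := cut_polar hn0 (bs ε) (fun σ : 𝔼 => φ (r • σ) ^ 2)
    have e2 := cut_polar hn0 (bs ε) (tang φ r)
    have e3 := cut_polar hn0 (deriv (bs ε)) (fun σ : 𝔼 => φ (r • σ) ^ 2)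
    simp only [hom] at h
    rw [e1, e2, e3, ← hS, ← hT] at h
    set C1 := ∫ r in Ioi (0:ℝ), bs ε (Real.log r) ^ 2 * Wt (n-1) r
    set C2 := ∫ r in Ioi (0:ℝ), deriv (bs ε) (Real.log r) ^ 2 * Wt (n-1) r
    have b1 : c0 ≤ C1 := by
      have : c0 = ∫ r in Ioc (1:ℝ) 2, bs ε (Real.log r) ^ 2 * Wt (n-1) r := by
        refine setIntegral_congr_fun measurableSet_Ioc fun r hr => ?_
        have hl0 : 0 ≤ Real.log r := Real.log_nonneg hr.1.le
        have hl1 : Real.log r ≤ 1 := by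
          have := Real.log_le_sub_one_of_pos (show 0 < r by linarith [hr.1])
          linarith [hr.2]
        have : bs ε (Real.log r) = 1 := bmp_one (by
          rw [abs_of_nonneg (by positivity)]
          nlinarith)
        simp only [this]; ring
      rw [this]
      refine setIntegral_mono_set (eta_int (bs_cd (k := 1) ε).continuous (fun s => hM' _) _) ?_ ?_
      · filter_upwards [ae_restrict_mem measurableSet_Ioi] with r hr
        exact mul_nonneg (sq_nonneg _) (Wt_nonneg _ (le_of_lt hr))
      · exact (show Ioc (1:ℝ) 2 ⊆ Ioi 0 from fun r hr => lt_trans one_pos hr.1).eventuallyLE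
    have b2 : C2 ≤ ε ^ 2 * M ^ 2 * I := by
      rw [hI, ← integral_const_mul]
      refine setIntegral_mono_on (eta_int (M := ε * M) ((bs_cd (k := 1) ε).continuous_deriv (by norm_num)) ?_ _) ((Wt_int _).const_mul _) measurableSet_Ioi ?_
      · intro s; rw [bs_deriv, norm_mul, Real.norm_of_nonneg h1.le]; gcongr; exact hM _
      · intro r hr
        refine mul_le_mul_of_nonneg_right ?_ (Wt_nonneg _ (le_of_lt hr))
        rw [bs_deriv, mul_pow]
        refine mul_le_mul_of_nonneg_left ?_ (sq_nonneg _)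
        exact sq_le_sq.2 (by rw [abs_of_nonneg hM0]; exact hM _)
    nlinarith
  have hlim : Tendsto (fun k : ℕ => (1 / ((k:ℝ) + 1)) ^ 2 * (M ^ 2 * I * S)) atTop (𝓝 (0 ^ 2 * (M ^ 2 * I * S))) :=
    (tendsto_one_div_add_atTop_nhds_zero_nat.pow 2).mul_const _
  have := ge_of_tendsto' hlim (fun k => key (1 / ((k:ℝ)+1)) (by positivity) (by
    rw [div_le_one (by positivity)]; linarith [show (0:ℝ) ≤ k by positivity]))
  nlinarith

lemma L4 (hn : 2 ≤ n) {φ : 𝔼 → ℝ} (hφ : Adm 1 φ) 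
    (h0 : ∀ r : ℝ, 0 < r → (∫ σ, φ (r • σ) ∂(sphMeasure n)) = 0) :
    ((n : ℝ) - 1) * ∫ x, φ x ^ 2 ≤ ∫ x, (‖x‖ ^ 2 * ‖fderiv ℝ φ x‖ ^ 2 - DD φ x ^ 2) := by
  have hφ1 : ContDiff ℝ 1 φ := by exact_mod_cast hφ.1
  have hfc := hφ1.continuous_fderiv (by norm_num)
  have i1 : Integrable fun x => φ x ^ 2 := ccint (hφ1.continuous.pow 2) (by simp only [pow_two]; exact hφ.2.1.mul_right)
  have i2 : Integrable fun x => ‖x‖ ^ 2 * ‖fderiv ℝ φ x‖ ^ 2 - DD φ x ^ 2 := by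
    refine ccint (((continuous_norm.pow 2).mul (hfc.norm.pow 2)).sub ((DD_cont hφ1).pow 2)) ?_
    refine (hφ.2.1.fderiv (𝕜 := ℝ)).mono ?_
    intro x hx
    simp only [DD, Function.mem_support] at hx ⊢
    intro h; rw [h] at hx; simp at hx
  have := polar_nonneg (n := n) (by omega) (i2.sub (i1.const_mul ((n:ℝ)-1))) ?_
  · simp only [Pi.sub_apply] at this
    rw [integral_sub i2 (i1.const_mul _), integral_const_mul] at this
    linarith
  · intro r hr
    have h := sph_poinc hn hφ1 r (h0 r hr)
    have hnt := nontriv hn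
    have c1 : Continuous fun σ : sphere (0:𝔼) 1 => φ (r • (σ:𝔼)) ^ 2 := 
      (hφ1.continuous.comp (continuous_subtype_val.const_smul r)).pow 2
    have c2 : Continuous fun σ : sphere (0:𝔼) 1 => tang φ r (σ:𝔼) := (tang_cont hφ1 r).comp continuous_subtype_val
    have ii : ∀ f : sphere (0:𝔼) 1 → ℝ, Continuous f → Integrable f ((volume : Measure 𝔼).toSphere) := fun f hf =>
      hf.integrable_of_hasCompactSupport (HasCompactSupport.of_compactSpace f)
    rw [sph_map, sph_map] at h
    rw [sph_map]
    have e : ∀ σ : sphere (0:𝔼) 1, ((fun x : 𝔼 => ‖x‖ ^ 2 * ‖fderiv ℝ φ x‖ ^ 2 - DD φ x ^ 2) - (fun x : 𝔼 => ((n:ℝ)-1) * φ x ^ 2) : 𝔼 → ℝ) (r • (σ:𝔼))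
      = tang φ r σ - ((n:ℝ)-1) * φ (r • (σ:𝔼)) ^ 2 := by
      intro σ
      have h1 : ‖(σ : 𝔼)‖ = 1 := by simp
      simp [tang, DD, norm_smul, h1]
      ring
    simp only [e]
    rw [integral_sub (ii _ c2) ((ii _ c1).const_mul _), integral_const_mul]
    linarith
end sp
end

open MeasureTheory Metric Set Filter
open scoped RealInnerProductSpace Topology
set_option linter.unusedSectionVars false
noncomputable section

section ineq
variable {n : ℕ}
local notation "𝔼" => EuclideanSpace ℝ (Fin n)

lemma pd_cd {k : ℕ} {u : 𝔼 → ℝ} (hu : ContDiff ℝ (k+1) u) (v : 𝔼) : ContDiff ℝ k fun y => fderiv ℝ u y v :=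
  (hu.fderiv_right le_rfl).clm_apply contDiff_const

lemma lap_eq {u : 𝔼 → ℝ} {x : 𝔼} (hu : ContDiffAt ℝ 2 u x) :
    lap u x = ∑ i : Fin n, fderiv ℝ (fun y => fderiv ℝ u y (EuclideanSpace.single i 1)) x (EuclideanSpace.single i 1) := by
  unfold lap
  refine Finset.sum_congr rfl fun i _ => ?_
  have hd : DifferentiableAt ℝ (fderiv ℝ u) x := (hu.fderiv_right (m := 1) (by norm_num)).differentiableAt (by norm_num)
  rw [iteratedFDeriv_two_apply, fderiv_clm_apply hd (differentiableAt_const _)]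
  simp

lemma dual_sum (L : 𝔼 →L[ℝ] ℝ) : ∑ i, (L (EuclideanSpace.single i 1)) ^ 2 = ‖L‖ ^ 2 := by
  obtain ⟨g, rfl⟩ := (InnerProductSpace.toDual ℝ 𝔼).surjective L
  rw [LinearIsometryEquiv.norm_map, EuclideanSpace.norm_sq_eq]
  refine Finset.sum_congr rfl fun i _ => ?_
  simp [EuclideanSpace.inner_single_right]

lemma lap_cont {u : 𝔼 → ℝ} (hu : ContDiff ℝ 2 u) : Continuous (lap u) := by
  have : lap u = fun x => ∑ i : Fin n, fderiv ℝ (fun y => fderiv ℝ u y (EuclideanSpace.single i 1)) x (EuclideanSpace.single i 1) := by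
    ext x; exact lap_eq hu.contDiffAt
  rw [this]
  refine continuous_finsetSum _ fun i _ => ?_
  have : ContDiff ℝ (1:ℕ) fun y => fderiv ℝ u y (EuclideanSpace.single i 1) := pd_cd (k := 1) (by norm_num; exact hu) _
  exact (this.continuous_fderiv (by norm_num)).clm_apply continuous_const

lemma lap_supp {u : 𝔼 → ℝ} (hc : HasCompactSupport u) : HasCompactSupport (lap u) := by
  refine (hc.iteratedFDeriv (𝕜 := ℝ) 2).mono ?_
  intro x hx
  simp only [lap, Function.mem_support] at hx ⊢
  intro h; rw [h] at hx; simp at hx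

lemma green {φ u : 𝔼 → ℝ} (hφ : ContDiff ℝ 1 φ) (hc : HasCompactSupport φ) (hu : ContDiff ℝ 2 u) :
    ∫ x, φ x * lap u x = - ∫ x, ∑ i : Fin n, fderiv ℝ φ x (EuclideanSpace.single i 1) * fderiv ℝ u x (EuclideanSpace.single i 1) := by
  have hp : ∀ i : Fin n, ContDiff ℝ 1 fun y => fderiv ℝ u y (EuclideanSpace.single i 1) := fun i => by
    have := pd_cd (k := 1) (u := u) (by norm_num; exact hu) (EuclideanSpace.single i 1)
    exact_mod_cast this
  have hφc := hφ.continuous_fderiv (by norm_num)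
  simp only [fun x => lap_eq (hu.contDiffAt (x := x)), Finset.mul_sum]
  rw [integral_finsetSum, integral_finsetSum, ← Finset.sum_neg_distrib]
  · exact Finset.sum_congr rfl fun i _ => ibp hφ (hp i) hc _
  · intro i _
    exact ccint ((hφc.clm_apply continuous_const).mul (hp i).continuous) (hc.fderiv_apply (𝕜 := ℝ) _).mul_right
  · intro i _
    exact ccint (hφ.continuous.mul (((hp i).continuous_fderiv (by norm_num)).clm_apply continuous_const)) hc.mul_right

lemma sq_cs {f : 𝔼 → ℝ} (h : HasCompactSupport f) : HasCompactSupport fun x => f x ^ 2 := by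
  simp only [pow_two]; exact h.mul_right

/-- `u / |x|^2` -/
def quo (u : 𝔼 → ℝ) (x : 𝔼) : ℝ := u x * (‖x‖ ^ 2)⁻¹

lemma quo_adm {k : ℕ} {u : 𝔼 → ℝ} (hu : Adm k u) : Adm k (quo u) :=
  hu.mul fun _ hx => ((norm_cd hx).pow 2).inv (pow_ne_zero 2 (norm_ne_zero_iff.2 hx))

lemma quo_eq {k : ℕ} {u : 𝔼 → ℝ} (hu : Adm k u) : u = fun x => ‖x‖ ^ 2 * quo u x := by
  ext x
  by_cases hx : x = 0
  · rw [hx, hu.zero]; simp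
  · have hx' : ‖x‖ ≠ 0 := norm_ne_zero_iff.2 hx
    simp only [quo]; field_simp

lemma quo_sq (u : 𝔼 → ℝ) (x : 𝔼) : (‖x‖ ^ 4)⁻¹ * (u x) ^ 2 = quo u x ^ 2 := by
  simp only [quo]; rw [mul_pow, ← inv_pow, ← inv_pow, ← pow_mul]; ring

lemma fd_sq_mul {φ : 𝔼 → ℝ} {x : 𝔼} (hφ : DifferentiableAt ℝ φ x) : 
    HasFDerivAt (fun x => ‖x‖ ^ 2 * φ x) ((2 * φ x) • innerSL ℝ x + ‖x‖ ^ 2 • fderiv ℝ φ x) x := by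
  refine ((hasStrictFDerivAt_norm_sq x).hasFDerivAt.mul hφ.hasFDerivAt).congr_fderiv ?_
  ext y; simp; ring

lemma rellich_nonrad (hn : 2 ≤ n) {u : 𝔼 → ℝ} (hu : Adm 2 u)
    (h0 : ∀ r : ℝ, 0 < r → (∫ σ, u (r • σ) ∂(sphMeasure n)) = 0) :
    (((n : ℝ) ^ 2 - 4) / 4) ^ 2 * (∫ x, (‖x‖ ^ 4)⁻¹ * (u x) ^ 2) ≤ ∫ x, (lap u x) ^ 2 := by
  have hφ := quo_adm hu
  have hue := quo_eq hu
  simp only [quo_sq]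
  have hm : ∀ r : ℝ, 0 < r → (∫ σ, quo u (r • σ) ∂(sphMeasure n)) = 0 := by
    intro r hr
    have h := h0 r hr
    rw [sph_map] at h ⊢
    have : ∀ σ : sphere (0:𝔼) 1, quo u (r • (σ:𝔼)) = u (r • (σ:𝔼)) * (r^2)⁻¹ := fun σ => by
      have h1 : ‖(σ : 𝔼)‖ = 1 := by simp
      simp [quo, norm_smul, h1]
    simp only [this]
    rw [integral_mul_const, h, zero_mul]
  set φ := quo u
  have hφ1 : ContDiff ℝ 1 φ := hφ.1.of_le (by norm_num)
  have hu2 : ContDiff ℝ 2 u := by exact_mod_cast hu.1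
  have hd := hφ1.differentiable (by norm_num)
  have hA := L4 hn (hφ.of_le (by norm_num)) hm
  have hH := hardy hφ1 hφ.2.1
  have hg := green hφ1 hφ.2.1 hu2
  have hD := int_mul_DD hφ1 hφ.2.1
  have i1 : Integrable fun x => φ x * DD φ x := ccint (hφ1.continuous.mul (DD_cont hφ1)) hφ.2.1.mul_right
  have i2 : Integrable fun x => φ x ^ 2 := ccint (hφ1.continuous.pow 2) (sq_cs hφ.2.1)
  have i3 : Integrable fun x => DD φ x ^ 2 := ccint ((DD_cont hφ1).pow 2) (sq_cs (DD_supp hφ.2.1))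
  have i4 : Integrable fun x => ‖x‖ ^ 2 * ‖fderiv ℝ φ x‖ ^ 2 := by
    refine ccint ((continuous_norm.pow 2).mul ((hφ1.continuous_fderiv (by norm_num)).norm.pow 2)) ?_
    refine (hφ.2.1.fderiv (𝕜 := ℝ)).mono ?_
    intro x hx
    simp only [Function.mem_support] at hx ⊢
    intro h; rw [h] at hx; simp at hx
  rw [integral_sub i4 i3] at hA
  have e : ∀ x, ∑ i : Fin n, fderiv ℝ φ x (EuclideanSpace.single i 1) * fderiv ℝ u x (EuclideanSpace.single i 1)
      = 2 * (φ x * DD φ x) + 1 * (‖x‖ ^ 2 * ‖fderiv ℝ φ x‖ ^ 2) + 0 * (φ x * DD φ x) := by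
    intro x
    have : fderiv ℝ u x = (2 * φ x) • innerSL ℝ x + ‖x‖ ^ 2 • fderiv ℝ φ x := by
      conv_lhs => rw [hue]
      exact (fd_sq_mul (hd x)).fderiv
    rw [this, DD_eq, ← dual_sum, Finset.mul_sum, Finset.mul_sum, Finset.mul_sum, zero_mul, add_zero, one_mul,
      ← Finset.sum_add_distrib]
    refine Finset.sum_congr rfl fun i _ => ?_
    simp [EuclideanSpace.inner_single_right]
    ring
  simp only [e] at hg
  rw [int_lin3 i1 i4 i1] at hg
  have hLc := lap_cont hu2
  have hLs := lap_supp hu.2.1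
  have i5 : Integrable fun x => lap u x ^ 2 := ccint (hLc.pow 2) (sq_cs hLs)
  have i6 : Integrable fun x => φ x * lap u x := ccint (hφ1.continuous.mul hLc) hφ.2.1.mul_right
  set C : ℝ := ((n : ℝ) ^ 2 - 4) / 4 with hC
  have hC0 : 0 ≤ C := by
    have : (2:ℝ) ≤ n := by exact_mod_cast hn
    rw [hC]; nlinarith
  have hs : 0 ≤ ∫ x, (lap u x + C * φ x) ^ 2 := integral_nonneg fun x => sq_nonneg _
  have e2 : ∀ x, (lap u x + C * φ x) ^ 2 = 1 * lap u x ^ 2 + (2 * C) * (φ x * lap u x) + C ^ 2 * φ x ^ 2 := fun x => by ring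
  simp only [e2] at hs
  rw [int_lin3 i5 i6 i2] at hs
  have key : C * (∫ x, φ x ^ 2) ≤ - ∫ x, φ x * lap u x := by
    rw [hC]; linarith
  nlinarith [mul_le_mul_of_nonneg_left key hC0]

lemma rellich_rad (hn : 2 ≤ n) {u : 𝔼 → ℝ} (hu : Adm 2 u) (hr : ∃ g : ℝ → ℝ, ∀ x, u x = g ‖x‖) :
    ((n : ℝ) * ((n : ℝ) - 4) / 4) ^ 2 * (∫ x, (‖x‖ ^ 4)⁻¹ * (u x) ^ 2) ≤ ∫ x, (lap u x) ^ 2 := by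
  have hφ := quo_adm hu
  have hue := quo_eq hu
  simp only [quo_sq]
  have hu2 : ContDiff ℝ 2 u := by exact_mod_cast hu.1
  have hud := hu2.differentiable (by norm_num)
  have hnt := nontriv hn
  obtain ⟨e, he⟩ := exists_norm_eq 𝔼 (zero_le_one)
  obtain ⟨g, hg⟩ := hr
  have hrad : ∀ x, u x = u (‖x‖ • e) := fun x => by rw [hg, hg]; simp [norm_smul, he]
  have hDu : Adm 1 (DD u) := by
    refine ⟨(hu2.fderiv_right (m := 1) (by norm_num)).clm_apply contDiff_id, DD_supp hu.2.1, ?_⟩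
    refine subset_trans ?_ hu.2.2
    refine subset_trans (closure_mono ?_) (tsupport_fderiv_subset ℝ (f := u))
    intro x hx
    simp only [DD, Function.mem_support] at hx ⊢
    intro h; rw [h] at hx; simp at hx
  have hp := quo_adm hDu
  set p := quo (DD u) with hpdef
  have hp1 : ContDiff ℝ 1 p := by exact_mod_cast hp.1
  have hpd := hp1.differentiable (by norm_num)
  have hfd : ∀ x, fderiv ℝ u x = p x • innerSL ℝ x := by
    intro x
    by_cases hx : x = 0
    · have : x ∉ tsupport u := fun h => hu.2.2 h hx
      have h2 : x ∉ tsupport (fderiv ℝ u) := fun h => this (tsupport_fderiv_subset ℝ h)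
      rw [image_eq_zero_of_notMem_tsupport h2, hx]; simp
    · have hx' : ‖x‖ ≠ 0 := norm_ne_zero_iff.2 hx
      have h1 : HasFDerivAt (fun y : 𝔼 => u (‖y‖ • e)) _ x :=
        (hud (‖x‖ • e)).hasFDerivAt.comp x ((norm_fd hx).smul_const e)
      have h2 : u = fun y : 𝔼 => u (‖y‖ • e) := funext hrad
      have h3 : fderiv ℝ u x = (fderiv ℝ u (‖x‖ • e) e * ‖x‖⁻¹) • innerSL ℝ x := by
        rw [← h2] at h1
        rw [h1.fderiv]
        ext y; simp; ring
      have h4 : p x = fderiv ℝ u (‖x‖ • e) e * ‖x‖⁻¹ := by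
        simp only [hpdef, quo, DD, h3]; simp; field_simp
      rw [h4, h3]
  have hlap : ∀ x, lap u x = n * p x + DD p x := by
    intro x
    rw [lap_eq hu2.contDiffAt, DD_eq]
    have : ∀ i : Fin n, fderiv ℝ (fun y => fderiv ℝ u y (EuclideanSpace.single i 1)) x (EuclideanSpace.single i 1) 
        = p x + x i * fderiv ℝ p x (EuclideanSpace.single i 1) := by
      intro i
      have h1 : (fun y => fderiv ℝ u y (EuclideanSpace.single i 1)) = fun y => p y * y i := by
        ext y; rw [hfd]; simp [EuclideanSpace.inner_single_right]
      have h2 : HasFDerivAt (fun x : 𝔼 => x i) (EuclideanSpace.proj (𝕜 := ℝ) i : 𝔼 →L[ℝ] ℝ) x :=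
        (EuclideanSpace.proj (𝕜 := ℝ) i : 𝔼 →L[ℝ] ℝ).hasFDerivAt
      rw [h1, fderiv_fun_mul (hpd x) h2.differentiableAt, h2.fderiv]
      simp
    simp only [this, Finset.sum_add_distrib]
    simp
  have hφ1 : ContDiff ℝ 1 (quo u) := hφ.1.of_le (by norm_num)
  set φ := quo u
  have hd := hφ1.differentiable (by norm_num)
  have hpφ : ∀ x, p x = DD φ x + 2 * φ x := by
    intro x
    by_cases hx : x = 0
    · rw [hx, hp.zero, hφ.zero, DD]; simp
    · have hx' : ‖x‖ ≠ 0 := norm_ne_zero_iff.2 hx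
      have : fderiv ℝ u x = (2 * φ x) • innerSL ℝ x + ‖x‖ ^ 2 • fderiv ℝ φ x := by
        conv_lhs => rw [hue]
        exact (fd_sq_mul (hd x)).fderiv
      simp only [hpdef, quo, DD, this]
      simp
      field_simp
      ring
  have hH := hardy hφ1 hφ.2.1
  have hD := int_mul_DD hφ1 hφ.2.1
  have i1 : Integrable fun x => φ x * DD φ x := ccint (hφ1.continuous.mul (DD_cont hφ1)) hφ.2.1.mul_right
  have i2 : Integrable fun x => φ x ^ 2 := ccint (hφ1.continuous.pow 2) (sq_cs hφ.2.1)
  have i3 : Integrable fun x => DD φ x ^ 2 := ccint ((DD_cont hφ1).pow 2) (sq_cs (DD_supp hφ.2.1))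
  have hH' := hardy hp1 hp.2.1
  have hD' := int_mul_DD hp1 hp.2.1
  have j1 : Integrable fun x => p x * DD p x := ccint (hp1.continuous.mul (DD_cont hp1)) hp.2.1.mul_right
  have j2 : Integrable fun x => p x ^ 2 := ccint (hp1.continuous.pow 2) (sq_cs hp.2.1)
  have j3 : Integrable fun x => DD p x ^ 2 := ccint ((DD_cont hp1).pow 2) (sq_cs (DD_supp hp.2.1))
  have e1 : ∫ x, lap u x ^ 2 = ∫ x, DD p x ^ 2 := by
    have : ∀ x, lap u x ^ 2 = (n:ℝ)^2 * p x ^ 2 + (2 * n) * (p x * DD p x) + 1 * DD p x ^ 2 := fun x => by rw [hlap]; ring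
    simp only [this]
    rw [int_lin3 j2 j1 j3, hD']; ring
  have e2 : ∫ x, p x ^ 2 = (∫ x, DD φ x ^ 2) + (4 - 2 * n) * ∫ x, φ x ^ 2 := by
    have : ∀ x, p x ^ 2 = 4 * φ x ^ 2 + 4 * (φ x * DD φ x) + 1 * DD φ x ^ 2 := fun x => by rw [hpφ]; ring
    simp only [this]
    rw [int_lin3 i2 i1 i3, hD]; ring
  have e3 : (((n:ℝ) - 4)/2)^2 * (∫ x, φ x ^ 2) ≤ ∫ x, p x ^ 2 := by
    rw [e2]; linarith
  rw [e1]
  have := mul_le_mul_of_nonneg_left e3 (sq_nonneg ((n:ℝ)/2))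
  linarith
end ineq
end

open MeasureTheory Metric Set Filter
open scoped RealInnerProductSpace Topology
set_option linter.unusedSectionVars false
noncomputable section

section sharp
variable {n : ℕ}
local notation "𝔼" => EuclideanSpace ℝ (Fin n)

lemma lap_rad {u p : 𝔼 → ℝ} (hu2 : ContDiff ℝ 2 u) (hpd : Differentiable ℝ p)
    (hfd : ∀ x, fderiv ℝ u x = p x • innerSL ℝ x) (x : 𝔼) : lap u x = n * p x + DD p x := by
  rw [lap_eq hu2.contDiffAt, DD_eq]
  have : ∀ i : Fin n, fderiv ℝ (fun y => fderiv ℝ u y (EuclideanSpace.single i 1)) x (EuclideanSpace.single i 1) 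
      = p x + x i * fderiv ℝ p x (EuclideanSpace.single i 1) := by
    intro i
    have h1 : (fun y => fderiv ℝ u y (EuclideanSpace.single i 1)) = fun y => p y * y i := by
      ext y; rw [hfd]; simp [EuclideanSpace.inner_single_right]
    have h2 : HasFDerivAt (fun x : 𝔼 => x i) (EuclideanSpace.proj (𝕜 := ℝ) i : 𝔼 →L[ℝ] ℝ) x :=
      (EuclideanSpace.proj (𝕜 := ℝ) i : 𝔼 →L[ℝ] ℝ).hasFDerivAt
    rw [h1, fderiv_fun_mul (hpd x) h2.differentiableAt, h2.fderiv]
    simp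
  simp only [this, Finset.sum_add_distrib]
  simp

lemma lap_mul {f g : 𝔼 → ℝ} (hf : ContDiff ℝ 2 f) (hg : ContDiff ℝ 2 g) (x : 𝔼) :
    lap (fun x => f x * g x) x = f x * lap g x + 2 * (∑ i : Fin n, fderiv ℝ f x (EuclideanSpace.single i 1) *
      fderiv ℝ g x (EuclideanSpace.single i 1)) + g x * lap f x := by
  have hfd := hf.differentiable (by norm_num)
  have hgd := hg.differentiable (by norm_num)
  have hf' : ∀ i : Fin n, DifferentiableAt ℝ (fun y => fderiv ℝ f y (EuclideanSpace.single i 1)) x := fun i =>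
    ((pd_cd (k := 1) (u := f) (by norm_num; exact hf) (EuclideanSpace.single i 1)).differentiable (by norm_num)) x
  have hg' : ∀ i : Fin n, DifferentiableAt ℝ (fun y => fderiv ℝ g y (EuclideanSpace.single i 1)) x := fun i =>
    ((pd_cd (k := 1) (u := g) (by norm_num; exact hg) (EuclideanSpace.single i 1)).differentiable (by norm_num)) x
  rw [lap_eq (hf.mul hg).contDiffAt, lap_eq hf.contDiffAt, lap_eq hg.contDiffAt, Finset.mul_sum, Finset.mul_sum, Finset.mul_sum,
    ← Finset.sum_add_distrib, ← Finset.sum_add_distrib]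
  refine Finset.sum_congr rfl fun i _ => ?_
  have e : (fun y => fderiv ℝ (fun x => f x * g x) y (EuclideanSpace.single i 1)) = fun y => 
      f y * fderiv ℝ g y (EuclideanSpace.single i 1) + g y * fderiv ℝ f y (EuclideanSpace.single i 1) := by
    ext y; rw [fderiv_fun_mul (hfd y) (hgd y)]; simp
  rw [e, fderiv_fun_add ((hfd x).fun_mul (hg' i)) ((hgd x).fun_mul (hf' i)), fderiv_fun_mul (hfd x) (hg' i), 
    fderiv_fun_mul (hgd x) (hf' i)]
  simp
  ring

lemma lap_cut {ζ : ℝ → ℝ} (hζ : ContDiff ℝ 3 ζ) (hc : HasCompactSupport ζ) (x : 𝔼) :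
    lap (cut ζ) x = (cut (deriv (deriv ζ)) x + ((n:ℝ) - 2) * cut (deriv ζ) x) * (‖x‖ ^ 2)⁻¹ := by
  have hζ1 : ContDiff ℝ 2 (deriv ζ) := by
    have : ContDiff ℝ (2 + 1) ζ := by norm_num; exact hζ
    exact (contDiff_succ_iff_deriv.1 this).2.2
  have hA : Adm 2 (cut ζ : 𝔼 → ℝ) := cut_adm (hζ.of_le (by norm_num)) hc
  have hA' : Adm 2 (cut (deriv ζ) : 𝔼 → ℝ) := cut_adm (by exact_mod_cast hζ1) hc.deriv
  have hp := quo_adm hA'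
  have hpd := hp.1.differentiable (by norm_num)
  rw [lap_rad (p := quo (cut (deriv ζ))) (by exact_mod_cast hA.1) hpd]
  · by_cases hx : x = 0
    · rw [hx]; simp [quo, DD]
    · have hx' : ‖x‖ ≠ 0 := norm_ne_zero_iff.2 hx
      have h1 : DD (cut (deriv ζ)) x = DD (fun x : 𝔼 => ‖x‖ ^ 2 * quo (cut (deriv ζ)) x) x := by
        rw [← quo_eq hA']
      rw [cut_DD (hζ1.of_le (by norm_num)), DD, (fd_sq_mul (hpd x)).fderiv] at h1
      simp only [smul_apply, add_apply, innerSL_apply_apply, real_inner_self_eq_norm_sq, smul_eq_mul] at h1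
      change _ = _ + _ * DD _ x at h1
      rw [h1]
      simp only [quo]
      field_simp
      ring
  · intro x
    by_cases hx : x = 0
    · have : x ∉ tsupport (cut ζ : 𝔼 → ℝ) := fun h => hA.2.2 h hx
      have h2 : x ∉ tsupport (fderiv ℝ (cut ζ : 𝔼 → ℝ)) := fun h => this (tsupport_fderiv_subset ℝ h)
      rw [image_eq_zero_of_notMem_tsupport h2, hx]; simp
    · rw [(cut_fd (hζ.of_le (by norm_num)) hx).fderiv]; rfl

/-- harmonic, homogeneous of degree k -/
structure HarmHom (k : ℕ) (P : 𝔼 → ℝ) : Prop where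
  cd : ContDiff ℝ 2 P
  harm : ∀ x, lap P x = 0
  euler : ∀ x, DD P x = k * P x
  hom : ∀ (c : ℝ) x, P (c • x) = c ^ k * P x

lemma hh_one : HarmHom 0 (fun _ : 𝔼 => (1:ℝ)) := by
  refine ⟨contDiff_const, fun x => ?_, fun x => ?_, fun c x => ?_⟩
  · rw [lap_eq contDiffAt_const]; simp
  · simp [DD]
  · simp

lemma hh_coord (j : Fin n) : HarmHom 1 (fun x : 𝔼 => x j) := by
  have hd : ∀ x, fderiv ℝ (fun x : 𝔼 => x j) x = EuclideanSpace.proj (𝕜 := ℝ) j := fun x =>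
    (EuclideanSpace.proj (𝕜 := ℝ) j : 𝔼 →L[ℝ] ℝ).hasFDerivAt.fderiv
  have hc : ContDiff ℝ 2 (fun x : 𝔼 => x j) := by fun_prop
  refine ⟨hc, fun x => ?_, fun x => ?_, fun c x => ?_⟩
  · rw [lap_eq hc.contDiffAt]; simp only [hd]; simp
  · simp [DD, hd]
  · simp

lemma lap_test {k : ℕ} {P : 𝔼 → ℝ} (hP : HarmHom k P) {ζ : ℝ → ℝ} (hζ : ContDiff ℝ 3 ζ) (hc : HasCompactSupport ζ) (x : 𝔼) :
    lap (fun x => cut ζ x * P x) x = 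
      (cut (deriv (deriv ζ)) x + ((n:ℝ) - 2 + 2 * k) * cut (deriv ζ) x) * (‖x‖ ^ 2)⁻¹ * P x := by
  have hA : Adm 2 (cut ζ : 𝔼 → ℝ) := cut_adm (hζ.of_le (by norm_num)) hc
  rw [lap_mul (by exact_mod_cast hA.1) hP.cd, hP.harm, lap_cut hζ hc]
  have : ∑ i : Fin n, fderiv ℝ (cut ζ) x (EuclideanSpace.single i 1) * fderiv ℝ P x (EuclideanSpace.single i 1)
    = cut (deriv ζ) x * (‖x‖ ^ 2)⁻¹ * (k * P x) := by
    by_cases hx : x = 0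
    · have : x ∉ tsupport (cut ζ : 𝔼 → ℝ) := fun h => hA.2.2 h hx
      have h2 : x ∉ tsupport (fderiv ℝ (cut ζ : 𝔼 → ℝ)) := fun h => this (tsupport_fderiv_subset ℝ h)
      rw [image_eq_zero_of_notMem_tsupport h2, hx]; simp
    · rw [(cut_fd (hζ.of_le (by norm_num)) hx).fderiv, ← hP.euler, DD_eq, Finset.mul_sum]
      refine Finset.sum_congr rfl fun i _ => ?_
      simp [EuclideanSpace.inner_single_right]
      ring
  rw [this]
  ring

lemma log_cov (h : ℝ → ℝ) : ∫ r in Ioi (0:ℝ), r⁻¹ * h (Real.log r) = ∫ s, h s := by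
  have := integral_image_eq_integral_abs_deriv_smul (s := univ) (f := Real.exp) (f' := Real.exp) MeasurableSet.univ
    (fun x _ => (Real.hasDerivAt_exp x).hasDerivWithinAt) Real.exp_injective.injOn (fun r => r⁻¹ * h (Real.log r))
  rw [image_univ, Real.range_exp] at this
  rw [this]
  simp only [Measure.restrict_univ]
  congr 1; ext s
  simp [abs_of_pos (Real.exp_pos s)]

/-- weighted integral of a test-type function. -/
lemma test_int (hn : 2 ≤ n) {k : ℕ} {P : 𝔼 → ℝ} (hP : HarmHom k P) {a ε : ℝ} (hε : 0 < ε) 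
    (ha : 2 * a = 4 - n - 2 * k) (g : ℝ → ℝ) :
    ∫ x : 𝔼, (cut (fun s => Real.exp (a * s) * g (ε * s)) x * (‖x‖ ^ 2)⁻¹ * P x) ^ 2 =
      (∫ σ, P σ ^ 2 ∂(sphMeasure n)) * (ε⁻¹ * ∫ s, g s ^ 2) := by
  have h := polar_prod (n := n) (by omega) (fun r => ((if r = 0 then 0 else Real.exp (a * Real.log r) * g (ε * Real.log r)) * (r ^ 2)⁻¹ * r ^ k) ^ 2)
    (fun σ => P σ ^ 2)
  have e1 : ∫ x : 𝔼, (cut (fun s => Real.exp (a * s) * g (ε * s)) x * (‖x‖ ^ 2)⁻¹ * P x) ^ 2 = 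
    ∫ x : 𝔼, ((if ‖x‖ = 0 then 0 else Real.exp (a * Real.log ‖x‖) * g (ε * Real.log ‖x‖)) * (‖x‖ ^ 2)⁻¹ * ‖x‖ ^ k) ^ 2 * P (‖x‖⁻¹ • x) ^ 2 := by
    congr 1; ext x
    by_cases hx : x = 0
    · simp [hx, cut]
    · have hx' : ‖x‖ ≠ 0 := norm_ne_zero_iff.2 hx
      rw [hP.hom]
      simp [cut, hx]
      field_simp
  rw [e1, h]
  congr 1
  have e2 := Measure.integral_comp_mul_left (fun s => g s ^ 2) ε
  rw [abs_of_pos (inv_pos.2 hε), smul_eq_mul] at e2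
  rw [← e2, ← log_cov]
  refine setIntegral_congr_fun measurableSet_Ioi fun r hr => ?_
  have hr' : 0 < r := hr
  simp only [if_neg hr'.ne']
  have h1 : Real.exp (a * Real.log r) ^ 2 * r ^ (n + 2 * k) = r ^ 4 := by
    have : r ^ (n + 2 * k) = Real.exp ((n + 2 * k) * Real.log r) := by
      rw [show ((n:ℝ) + 2 * k) = ((n + 2 * k : ℕ) : ℝ) by push_cast; ring, Real.exp_nat_mul, Real.exp_log hr']
    rw [this, ← Real.exp_nat_mul, ← Real.exp_add]
    have h4 : r ^ 4 = Real.exp ((4:ℕ) * Real.log r) := by rw [Real.exp_nat_mul, Real.exp_log hr']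
    rw [h4]; congr 1
    push_cast
    linear_combination (Real.log r) * ha
  have h2 : r ^ (n - 1) * r = r ^ n := by rw [← pow_succ]; congr 1; omega
  have h3 : r ^ (n - 1) = r ^ n * r⁻¹ := by rw [← h2]; field_simp
  have h4 : r ^ (n + 2 * k) = r ^ n * (r ^ k) ^ 2 := by ring
  rw [h3]
  rw [h4] at h1
  have h5 : (Real.exp (a * Real.log r) ^ 2 * (r ^ n * (r ^ k) ^ 2)) * (r ^ 4)⁻¹ = 1 := by rw [h1]; field_simp
  calc _ = r⁻¹ * g (ε * Real.log r) ^ 2 * ((Real.exp (a * Real.log r) ^ 2 * (r ^ n * (r ^ k) ^ 2)) * (r ^ 4)⁻¹) := by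
        field_simp
    _ = _ := by rw [h5, mul_one]

lemma den_pos {u : 𝔼 → ℝ} (hu : Adm 2 u) (h : ∃ x, u x ≠ 0) : 0 < ∫ x, (‖x‖ ^ 4)⁻¹ * (u x) ^ 2 := by
  simp only [quo_sq]
  have hφ := quo_adm hu
  obtain ⟨x, hx⟩ := h
  have hx0 : x ≠ 0 := fun h => hx (h ▸ hu.zero)
  refine Continuous.integral_pos_of_hasCompactSupport_nonneg_nonzero (x := x) (hφ.1.continuous.pow 2) (sq_cs hφ.2.1) (fun x => sq_nonneg _) ?_
  have hx' : ‖x‖ ≠ 0 := norm_ne_zero_iff.2 hx0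
  simp [quo, hx, hx']

end sharp
end

open MeasureTheory Metric Set Filter
open scoped RealInnerProductSpace Topology
set_option linter.unusedSectionVars false
noncomputable section

section sharp2
variable {n : ℕ}
local notation "𝔼" => EuclideanSpace ℝ (Fin n)

lemma exp_deriv (a ε : ℝ) {h : ℝ → ℝ} (hh : Differentiable ℝ h) :
    deriv (fun s => Real.exp (a * s) * h (ε * s)) = 
      fun s => Real.exp (a * s) * (fun t => a * h t + ε * deriv h t) (ε * s) := by
  ext s
  have h1 : HasDerivAt (fun s => Real.exp (a * s)) (Real.exp (a * s) * (a * 1)) s :=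
    ((hasDerivAt_id s).const_mul a).exp
  have h2 : HasDerivAt (fun s => h (ε * s)) (deriv h (ε * s) * (ε * 1)) s :=
    (hh (ε * s)).hasDerivAt.comp s ((hasDerivAt_id s).const_mul ε)
  rw [(h1.fun_mul h2).deriv]
  ring

lemma bmp_d1 {k : ℕ} : ContDiff ℝ k (deriv bmp) := 
  (contDiff_succ_iff_deriv.1 (by exact_mod_cast bmp_cd (k := k + 1))).2.2

lemma bmp_d2 {k : ℕ} : ContDiff ℝ k (deriv (deriv bmp)) := 
  (contDiff_succ_iff_deriv.1 (by exact_mod_cast bmp_d1 (k := k + 1))).2.2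

/-- the limit one dimensional numerator -/
def NumI (κ ε : ℝ) : ℝ := ∫ s, (κ * bmp s + 2 * ε * deriv bmp s + ε ^ 2 * deriv (deriv bmp) s) ^ 2

lemma num_cont (κ : ℝ) : Continuous (NumI κ) := by
  have c0 := (bmp_cd (k := 1)).continuous
  have c1 := (bmp_d1 (k := 1)).continuous
  have c2 := (bmp_d2 (k := 1)).continuous
  have s0 := bmp_cs
  have s1 := bmp_cs.deriv
  have s2 := bmp_cs.deriv.deriv
  have i00 : Integrable fun s => bmp s * bmp s := (c0.mul c0).integrable_of_hasCompactSupport s0.mul_right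
  have i01 : Integrable fun s => bmp s * deriv bmp s := (c0.mul c1).integrable_of_hasCompactSupport s0.mul_right
  have i02 : Integrable fun s => bmp s * deriv (deriv bmp) s := (c0.mul c2).integrable_of_hasCompactSupport s0.mul_right
  have i11 : Integrable fun s => deriv bmp s * deriv bmp s := (c1.mul c1).integrable_of_hasCompactSupport s1.mul_right
  have i12 : Integrable fun s => deriv bmp s * deriv (deriv bmp) s := (c1.mul c2).integrable_of_hasCompactSupport s1.mul_right
  have i22 : Integrable fun s => deriv (deriv bmp) s * deriv (deriv bmp) s := (c2.mul c2).integrable_of_hasCompactSupport s2.mul_right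
  have : NumI κ = fun ε => κ^2 * (∫ s, bmp s * bmp s) + 4 * κ * ε * (∫ s, bmp s * deriv bmp s) + 
      2 * κ * ε^2 * (∫ s, bmp s * deriv (deriv bmp) s) + 4 * ε^2 * (∫ s, deriv bmp s * deriv bmp s) + 
      4 * ε^3 * (∫ s, deriv bmp s * deriv (deriv bmp) s) + ε^4 * (∫ s, deriv (deriv bmp) s * deriv (deriv bmp) s) := by
    ext ε
    unfold NumI
    simp only [← integral_const_mul]
    have j00 := i00.const_mul (κ^2)
    have j01 := i01.const_mul (4 * κ * ε)
    have j02 := i02.const_mul (2 * κ * ε^2)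
    have j11 := i11.const_mul (4 * ε^2)
    have j12 := i12.const_mul (4 * ε^3)
    have j22 := i22.const_mul (ε^4)
    have k1 := j00.fun_add j01
    have k2 := k1.fun_add j02
    have k3 := k2.fun_add j11
    have k4 := k3.fun_add j12
    rw [← integral_add j00 j01, ← integral_add k1 j02, ← integral_add k2 j11, ← integral_add k3 j12, ← integral_add k4 j22]
    congr 1; ext s; ring
  rw [this]
  fun_prop

lemma num_zero (κ : ℝ) : NumI κ 0 = κ ^ 2 * ∫ s, bmp s ^ 2 := by
  unfold NumI
  rw [← integral_const_mul]
  congr 1; ext s; ring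

lemma bmp_int_pos : 0 < ∫ s, bmp s ^ 2 := by
  refine Continuous.integral_pos_of_hasCompactSupport_nonneg_nonzero (x := 0) ((bmp_cd (k := 1)).continuous.pow 2) ?_ (fun x => sq_nonneg _) ?_
  · simp only [pow_two]; exact bmp_cs.mul_right
  · rw [bmp_one (by simp)]; norm_num

lemma sharp_test (hn : 2 ≤ n) {k : ℕ} {P : 𝔼 → ℝ} (hP : HarmHom k P) {e : 𝔼} (he : ‖e‖ = 1) (hPe : P e ≠ 0)
    {δ : ℝ} (hδ : 0 < δ) : ∃ ζ : ℝ → ℝ, ContDiff ℝ 3 ζ ∧ HasCompactSupport ζ ∧ (∃ x : 𝔼, cut ζ x * P x ≠ 0) ∧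
      (∫ x : 𝔼, lap (fun x => cut ζ x * P x) x ^ 2) / (∫ x : 𝔼, (‖x‖ ^ 4)⁻¹ * (cut ζ x * P x) ^ 2) <
        ((4 - n - 2 * k) * (n + 2 * k) / 4) ^ 2 + δ := by
  set κ : ℝ := (4 - n - 2 * k) * (n + 2 * k) / 4 with hκ
  set a : ℝ := (4 - n - 2 * k) / 2 with ha
  have hlim : Tendsto (fun ε => NumI κ ε / ∫ s, bmp s ^ 2) (𝓝[>] 0) (𝓝 (κ ^ 2)) := by
    have h := ((num_cont κ).div_const (∫ s, bmp s ^ 2)).tendsto 0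
    rw [num_zero, mul_div_cancel_right₀ _ bmp_int_pos.ne'] at h
    exact h.mono_left nhdsWithin_le_nhds
  obtain ⟨ε, hε1, hε⟩ := ((hlim.eventually_lt_const (show κ ^ 2 < κ ^ 2 + δ by linarith)).and self_mem_nhdsWithin).exists
  have hε0 : 0 < ε := hε
  set ζ : ℝ → ℝ := fun s => Real.exp (a * s) * bmp (ε * s) with hζ
  have h1 : ContDiff ℝ 3 ζ := by
    have := (contDiff_const.mul contDiff_id).exp.mul (bs_cd (k := 3) ε) (f := fun s => Real.exp (a * s))
    exact_mod_cast this
  have h2 : HasCompactSupport ζ := (bs_cs hε0.ne').mul_left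
  have hx : ∃ x : 𝔼, cut ζ x * P x ≠ 0 := by
    refine ⟨e, mul_ne_zero ?_ hPe⟩
    have : e ≠ 0 := by rw [← norm_ne_zero_iff, he]; norm_num
    simp [cut, this, he, hζ, bmp_one]
  have hA : Adm 2 (fun x : 𝔼 => cut ζ x * P x) := 
    (cut_adm (h1.of_le (by norm_num)) h2).mul fun x _ => hP.cd.contDiffAt
  refine ⟨ζ, h1, h2, hx, ?_⟩
  have hden := den_pos hA hx
  have e1 : ∫ x : 𝔼, (‖x‖ ^ 4)⁻¹ * (cut ζ x * P x) ^ 2 = (∫ σ, P σ ^ 2 ∂(sphMeasure n)) * (ε⁻¹ * ∫ s, bmp s ^ 2) := by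
    rw [← test_int hn hP hε0 (a := a) (by rw [ha]; ring)]
    congr 1; ext x
    rw [quo_sq (fun x => cut ζ x * P x) x]
    simp only [quo, hζ]; ring
  have e2 : ∫ x : 𝔼, lap (fun x => cut ζ x * P x) x ^ 2 = (∫ σ, P σ ^ 2 ∂(sphMeasure n)) * (ε⁻¹ * NumI κ ε) := by
    rw [NumI, ← test_int hn hP hε0 (a := a) (by rw [ha]; ring)]
    congr 1; ext x
    rw [lap_test hP h1 h2]
    congr 3
    have hb1 := (bmp_cd (k := 1)).differentiable (by norm_num)
    have hb2 := (bmp_d1 (k := 1)).differentiable (by norm_num)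
    have d1 : deriv ζ = _ := exp_deriv a ε hb1
    have hb3 : Differentiable ℝ (fun t => a * bmp t + ε * deriv bmp t) := (hb1.const_mul a).fun_add (hb2.const_mul ε)
    have d2 : deriv (deriv ζ) = _ := (congrArg deriv d1).trans (exp_deriv a ε hb3)
    have d3 : ∀ t, deriv (fun t => a * bmp t + ε * deriv bmp t) t = a * deriv bmp t + ε * deriv (deriv bmp) t := fun t => by
      rw [deriv_fun_add ((hb1 t).const_mul a) ((hb2 t).const_mul ε), deriv_const_mul _ (hb1 t), deriv_const_mul _ (hb2 t)]
    rw [d2, d1]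
    by_cases hx : x = 0
    · simp [cut, hx]
    · simp only [cut, if_neg hx, d3]
      simp only [hκ, ha]
      ring
  rw [e1] at hden
  have hS : (∫ σ, P σ ^ 2 ∂(sphMeasure n)) ≠ 0 := fun h => by rw [h] at hden; simp at hden
  rw [e1, e2, mul_div_mul_left _ _ hS, mul_div_mul_left _ _ (inv_ne_zero hε0.ne')]
  exact hε1

lemma coord_mean (hn : 2 ≤ n) (j : Fin n) : ∫ σ : 𝔼, σ j ∂(sphMeasure n) = 0 := by
  have h := polar_prod (n := n) (by omega) (fun r => Real.exp (-(1/2) * r ^ 2)) (fun σ => σ j)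
  have h1 : ∫ x : 𝔼, Real.exp (-(1/2) * ‖x‖ ^ 2) * (‖x‖⁻¹ • x) j = 0 := by
    have h2 := integral_neg_eq_self (μ := (volume : Measure 𝔼)) (fun x : 𝔼 => Real.exp (-(1/2) * ‖x‖ ^ 2) * (‖x‖⁻¹ • x) j)
    have h3 : ∀ x : 𝔼, Real.exp (-(1/2) * ‖-x‖ ^ 2) * (‖-x‖⁻¹ • (-x)) j = -(Real.exp (-(1/2) * ‖x‖ ^ 2) * (‖x‖⁻¹ • x) j) := by
      intro x; simp
    simp only [h3] at h2
    rw [integral_neg] at h2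
    linarith
  rw [h1] at h
  have hI : 0 < ∫ r in Ioi (0:ℝ), Wt (n-1) r := by
    refine (Wt_pos (n-1)).trans_le (setIntegral_mono_set (Wt_int _) ?_ ?_)
    · filter_upwards [ae_restrict_mem measurableSet_Ioi] with r hr
      exact Wt_nonneg _ (le_of_lt hr)
    · exact (show Ioc (1:ℝ) 2 ⊆ Ioi 0 from fun r hr => lt_trans one_pos hr.1).eventuallyLE
  rcases mul_eq_zero.1 h.symm with h | h
  · exact h
  · exact absurd h hI.ne'

lemma sInf_eq_of {S : Set ℝ} {c : ℝ} (h1 : ∀ q ∈ S, c ≤ q) (h2 : ∀ δ > 0, ∃ q ∈ S, q < c + δ) : sInf S = c := by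
  obtain ⟨q, hq, -⟩ := h2 1 one_pos
  refine csInf_eq_of_forall_ge_of_forall_gt_exists_lt ⟨q, hq⟩ h1 fun w hw => ?_
  obtain ⟨q, hq, h⟩ := h2 (w - c) (by linarith)
  exact ⟨q, hq, by linarith⟩

end sharp2
end
noncomputable section

/-- the sharp Rellich inequalities for `α = 0` on radial
functions and on functions with zero spherical means, in any dimension `n ≥ 2`. -/
theorem rellich_alpha_zero_radial_nonradial {n : ℕ} (hn : 2 ≤ n) :
    (∀ u : EuclideanSpace ℝ (Fin n) → ℝ,
      DirichletAdm {(0 : EuclideanSpace ℝ (Fin n))}ᶜ u →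
      (∃ g : ℝ → ℝ, ∀ x, u x = g ‖x‖) →
      ((n : ℝ) * ((n : ℝ) - 4) / 4) ^ 2 * (∫ x, (‖x‖ ^ 4)⁻¹ * (u x) ^ 2) ≤
        ∫ x, (lap u x) ^ 2) ∧
    (∀ u : EuclideanSpace ℝ (Fin n) → ℝ,
      DirichletAdm {(0 : EuclideanSpace ℝ (Fin n))}ᶜ u →
      (∀ r : ℝ, 0 < r → (∫ σ, u (r • σ) ∂(sphMeasure n)) = 0) →
      (((n : ℝ) ^ 2 - 4) / 4) ^ 2 * (∫ x, (‖x‖ ^ 4)⁻¹ * (u x) ^ 2) ≤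
        ∫ x, (lap u x) ^ 2) ∧
    sInf {q : ℝ | ∃ u : EuclideanSpace ℝ (Fin n) → ℝ,
        DirichletAdm {(0 : EuclideanSpace ℝ (Fin n))}ᶜ u ∧
        (∃ g : ℝ → ℝ, ∀ x, u x = g ‖x‖) ∧ (∃ x, u x ≠ 0) ∧
        q = (∫ x, (lap u x) ^ 2) / (∫ x, (‖x‖ ^ 4)⁻¹ * (u x) ^ 2)} =
      ((n : ℝ) * ((n : ℝ) - 4) / 4) ^ 2 ∧
    sInf {q : ℝ | ∃ u : EuclideanSpace ℝ (Fin n) → ℝ,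
        DirichletAdm {(0 : EuclideanSpace ℝ (Fin n))}ᶜ u ∧
        (∀ r : ℝ, 0 < r → (∫ σ, u (r • σ) ∂(sphMeasure n)) = 0) ∧ (∃ x, u x ≠ 0) ∧
        q = (∫ x, (lap u x) ^ 2) / (∫ x, (‖x‖ ^ 4)⁻¹ * (u x) ^ 2)} =
      (((n : ℝ) ^ 2 - 4) / 4) ^ 2 := by
  have hadm : ∀ u : EuclideanSpace ℝ (Fin n) → ℝ, DirichletAdm {(0 : EuclideanSpace ℝ (Fin n))}ᶜ u ↔ Adm 2 u :=
    fun u => Iff.rfl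
  let j : Fin n := ⟨0, by omega⟩
  have he : ‖(EuclideanSpace.single j 1 : EuclideanSpace ℝ (Fin n))‖ = 1 := by simp
  refine ⟨fun u hu h => rellich_rad hn hu h, fun u hu h => rellich_nonrad hn hu h, ?_, ?_⟩
  · refine sInf_eq_of ?_ ?_
    · rintro q ⟨u, hu, hr, hx, rfl⟩
      rw [le_div_iff₀ (den_pos hu hx)]
      exact rellich_rad hn hu hr
    · intro δ hδ
      obtain ⟨ζ, h1, h2, hx, h3⟩ := sharp_test hn hh_one he one_ne_zero hδ
      refine ⟨_, ⟨fun x => cut ζ x * 1, ?_, ?_, hx, rfl⟩, h3.trans_eq ?_⟩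
      · exact (hadm _).2 ((cut_adm (h1.of_le (by norm_num)) h2).mul fun x _ => contDiffAt_const)
      · exact ⟨fun r => if r = 0 then 0 else ζ (Real.log r), fun x => by simp [cut]⟩
      · push_cast; ring
  · refine sInf_eq_of ?_ ?_
    · rintro q ⟨u, hu, hr, hx, rfl⟩
      rw [le_div_iff₀ (den_pos hu hx)]
      exact rellich_nonrad hn hu hr
    · intro δ hδ
      obtain ⟨ζ, h1, h2, hx, h3⟩ := sharp_test hn (hh_coord j) he (by simp) hδ
      refine ⟨_, ⟨fun x => cut ζ x * x j, ?_, ?_, hx, rfl⟩, h3.trans_eq ?_⟩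
      · exact (hadm _).2 ((cut_adm (h1.of_le (by norm_num)) h2).mul fun x _ => (hh_coord j).cd.contDiffAt)
      · intro r hr
        have hm := coord_mean hn j
        rw [sph_map] at hm ⊢
        have : ∀ σ : sphere (0 : EuclideanSpace ℝ (Fin n)) 1, cut ζ (r • (σ : EuclideanSpace ℝ (Fin n))) * (r • (σ : EuclideanSpace ℝ (Fin n))) j
            = (ζ (Real.log r) * r) * (σ : EuclideanSpace ℝ (Fin n)) j := by
          intro σ
          have hs1 : ‖(σ : EuclideanSpace ℝ (Fin n))‖ = 1 := by simp
          have hs0 : (σ : EuclideanSpace ℝ (Fin n)) ≠ 0 := by rw [← norm_ne_zero_iff, hs1]; norm_num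
          simp [cut, hs0, hr.ne', norm_smul, hs1, abs_of_pos hr]
          ring
        simp only [this]
        rw [integral_const_mul, hm, mul_zero]
      · push_cast; ring

end
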